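/- In the Setup, if two points x' and x'' of X have the same c*_X-color 𝔠 and there exists an r-chain from x' to x'' all of whose points have c*_X-color 𝔠, then d(x', x'') ≤ 300·f(r). Consequently, every r-scale connected component of each c*_X-color class is 300·f(r)-bounded, and X has dimension ≤ n at scale r of magnitude 300·f(r). -/

import Mathlib

open Set Metric

section Core

variable {X : Type*} [MetricSpace X]

/-- A geodesic segment parametrized by the interval `[a, b]`:
an isometric embedding of `[a, b]` into `X`. -/
def IsGeodesicSegment (γ : ℝ → X) (a b : ℝ) : Prop :=
  ∀ s ∈ Set.Icc a b, ∀ t ∈ Set.Icc a b, dist (γ s) (γ t) = |s - t|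

/-- A metric space is geodesic if every two points are joined by a geodesic. -/
def GeodesicSpace (X : Type*) [MetricSpace X] : Prop :=
  ∀ x y : X, ∃ γ : ℝ → X, IsGeodesicSegment γ 0 (dist x y) ∧ γ 0 = x ∧ γ (dist x y) = y

/-- A subset is geodesic if every two of its points are joined by a geodesic of `X`
contained in the subset. -/
def IsGeodesicSubset (S : Set X) : Prop :=
  ∀ x ∈ S, ∀ y ∈ S, ∃ γ : ℝ → X, IsGeodesicSegment γ 0 (dist x y) ∧ γ 0 = x ∧
    γ (dist x y) = y ∧ ∀ t ∈ Set.Icc (0 : ℝ) (dist x y), γ t ∈ S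

/-- A (complete geodesic) metric space is tree-graded with respect to a collection `PX`
of closed geodesic subsets (pieces) covering `X` if every two different pieces meet in
at most one point (T₁) and every simple loop (injective continuous image of a circle)
is contained in one piece (T₂''). -/
structure IsTreeGraded (X : Type*) [MetricSpace X] (PX : Set (Set X)) : Prop where
  nonempty : ∀ P ∈ PX, P.Nonempty
  closed : ∀ P ∈ PX, IsClosed P
  geodesicSub : ∀ P ∈ PX, IsGeodesicSubset P
  covers : ∀ x : X, ∃ P ∈ PX, x ∈ P
  t1 : ∀ P ∈ PX, ∀ Q ∈ PX, P ≠ Q → (P ∩ Q).Subsingleton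
  t2 : ∀ loop : AddCircle (1 : ℝ) → X, Continuous loop → Function.Injective loop →
    ∃ P ∈ PX, Set.range loop ⊆ P

end Core
section Chains

variable {Y : Type*}

/-- An `r`-chain from `x` to `y` inside the set `S`, with respect to the distance
function `d`: a finite sequence `x = c 0, c 1, …, c m = y` of points of `S` with
consecutive distances `< r`. -/
def IsDChain (d : Y → Y → ℝ) (r : ℝ) (S : Set Y) (x y : Y) : Prop :=
  ∃ (m : ℕ) (c : ℕ → Y), c 0 = x ∧ c m = y ∧ (∀ i ≤ m, c i ∈ S) ∧
    ∀ i < m, d (c i) (c (i + 1)) < r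

/-- A set is `r`-scale connected if every two of its points are joined by an
`r`-chain contained in it. -/
def DScaleConnected (d : Y → Y → ℝ) (r : ℝ) (S : Set Y) : Prop :=
  ∀ x ∈ S, ∀ y ∈ S, IsDChain d r S x y

/-- `C` is an `r`-scale connected component of `U`: a maximal `r`-scale connected
subset of `U`. -/
def IsDComponent (d : Y → Y → ℝ) (r : ℝ) (U C : Set Y) : Prop :=
  C ⊆ U ∧ DScaleConnected d r C ∧
    ∀ C', C ⊆ C' → C' ⊆ U → DScaleConnected d r C' → C = C'

/-- A set is `M`-bounded: its diameter is at most `M`. -/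
def DBounded (d : Y → Y → ℝ) (M : ℝ) (S : Set Y) : Prop :=
  ∀ x ∈ S, ∀ y ∈ S, d x y ≤ M

/-- A space has dimension `≤ n` at scale `s` of magnitude `M` if there is a cover by
`n + 1` sets such that every `s`-scale connected component of each of them is
`M`-bounded. -/
def DimLeAtScale (d : Y → Y → ℝ) (n : ℕ) (s M : ℝ) : Prop :=
  ∃ U : Fin (n + 1) → Set Y, (∀ y, ∃ i, y ∈ U i) ∧
    ∀ i C, IsDComponent d s (U i) C → DBounded d M C

end Chains
section TreeGradedColoring

variable {X : Type*} [MetricSpace X]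

/-- The `r`-scale connected component `𝔠_P` of `c_P`-color `0` of the piece `P`
containing its base point `x_P = proj P x̂`: the set of points of `P` reachable from
`x_P` by an `r`-chain of points of `P` of `c_P`-color `0`. -/
def pieceComp (r : ℝ) {n : ℕ} (xhat : X) (proj : Set X → X → X)
    (cP : Set X → X → Fin (n + 1)) (P : Set X) : Set X :=
  {y | IsDChain dist r {z | z ∈ P ∧ cP P z = 0} (proj P xhat) y}

/-- `P` is a long piece of the geodesic `γ : [0, L] → X` (from `x̂` to `x = γ L`):
`γ` meets `P` and the exit point `π_P x` does not belong to `𝔠_P`. -/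
def IsLongPiece (PX : Set (Set X)) (r : ℝ) {n : ℕ} (xhat : X)
    (proj : Set X → X → X) (cP : Set X → X → Fin (n + 1))
    (γ : ℝ → X) (L : ℝ) (P : Set X) : Prop :=
  P ∈ PX ∧ (∃ t ∈ Set.Icc 0 L, γ t ∈ P) ∧
    proj P (γ L) ∉ pieceComp r xhat proj cP P

/-- The parameter at which the geodesic `γ : [0, L] → X` enters the piece `P`. -/
noncomputable def pieceStart (γ : ℝ → X) (L : ℝ) (P : Set X) : ℝ :=
  sInf {t | t ∈ Set.Icc 0 L ∧ γ t ∈ P}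

/-- The parameter at which the geodesic `γ : [0, L] → X` exits the piece `P`. -/
noncomputable def pieceEnd (γ : ℝ → X) (L : ℝ) (P : Set X) : ℝ :=
  sSup {t | t ∈ Set.Icc 0 L ∧ γ t ∈ P}

/-- The complement in `γ : [0, L] → X` (in parameter space) of the interiors of all
reduced long pieces of `γ`; its connected components are the subpaths `β₁, …, β_k`. -/
noncomputable def betaSet (PX : Set (Set X)) (r : ℝ) {n : ℕ} (xhat : X)
    (proj : Set X → X → X) (cP : Set X → X → Fin (n + 1))
    (γ : ℝ → X) (L : ℝ) : Set ℝ :=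
  Set.Icc 0 L \
    ⋃ P ∈ {P | IsLongPiece PX r xhat proj cP γ L P},
      Set.Ioo (pieceStart γ L P + r / 2) (pieceEnd γ L P)

/-- The length `|⌊β⌋|` of the initial part of the subpath `β = γ|[a,b]`, where
`⌊β⌋` goes from `β₋ = γ a` to the entry point `β′` of the piece of the induced
tree-graded structure on `β` containing `β₊ = γ b`. -/
noncomputable def floorLen (PX : Set (Set X)) (γ : ℝ → X) (a b : ℝ) : ℝ :=
  sInf {t | t ∈ Set.Icc a b ∧ ∃ P ∈ PX, γ '' Set.Icc t b ⊆ P} - a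

/-- `v` is the value at `x = γ L` of the coloring `c*_X` computed along the geodesic
`γ : [0, L] → X` from `x̂` to `x`:
`v = Σ_P c_P(π_P x) + Σᵢ ⌊ |⌊βᵢ⌋| / (99 f(r)) ⌋ (mod n+1)`,
where the first sum is over the (finitely many) pieces with a nonzero term and
`β₁, …, β_k` are the connected components of the complement in `γ` of the interiors
of the reduced long pieces of `γ`. -/
def ColorValue (PX : Set (Set X)) (r fr : ℝ) {n : ℕ} (xhat : X)
    (proj : Set X → X → X) (cP : Set X → X → Fin (n + 1))
    (γ : ℝ → X) (L : ℝ) (v : Fin (n + 1)) : Prop :=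
  ∃ (Ps : Finset (Set X)) (k : ℕ) (a b : Fin k → ℝ),
    (↑Ps : Set (Set X)) = {P | P ∈ PX ∧ cP P (proj P (γ L)) ≠ 0} ∧
    (∀ i, a i ≤ b i) ∧
    (betaSet PX r xhat proj cP γ L = ⋃ i, Set.Icc (a i) (b i)) ∧
    (∀ i j, i ≠ j → b i < a j ∨ b j < a i) ∧
    (v : ℕ) =
      ((Ps.sum fun P => ((cP P (proj P (γ L)) : ℕ))) +
        (Finset.univ.sum fun i : Fin k =>
          Nat.floor (floorLen PX γ (a i) (b i) / (99 * fr)))) % (n + 1)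

/-- The Setup: `X` is a geodesic metric space, tree-graded with respect to `PX`, pieces
do not contain other pieces; `n` is a positive integer, `r > 0` and `f(r) ≥ r`;
`proj P` is the nearest-point projection onto the piece `P`; `x̂` is a base point and
`x_P = proj P x̂`; `c_P` is a coloring of each piece `P` by `n + 1` colors such that
`r`-components of every nonzero color are `f(r)`-bounded, `r`-components of color `0`
are `8 f(r)`-bounded, and `c_P` vanishes on the closed ball `B(x_P, 2r)`. -/
structure ColoringSetup (X : Type*) [MetricSpace X] (PX : Set (Set X)) (n : ℕ)
    (r fr : ℝ) (xhat : X) (proj : Set X → X → X)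
    (cP : Set X → X → Fin (n + 1)) : Prop where
  geodesic : GeodesicSpace X
  treeGraded : IsTreeGraded X PX
  noPieceContainsPiece : ∀ P ∈ PX, ∀ Q ∈ PX, P ⊆ Q → P = Q
  npos : 0 < n
  rpos : 0 < r
  rlefr : r ≤ fr
  projMem : ∀ P ∈ PX, ∀ x : X, proj P x ∈ P
  projDist : ∀ P ∈ PX, ∀ x : X, dist x (proj P x) = Metric.infDist x P
  ballZero : ∀ P ∈ PX, ∀ y ∈ P, dist y (proj P xhat) ≤ 2 * r → cP P y = 0
  nonzeroBounded : ∀ P ∈ PX, ∀ j : Fin (n + 1), j ≠ 0 →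
    ∀ x y : X, IsDChain dist r {z | z ∈ P ∧ cP P z = j} x y → dist x y ≤ fr
  zeroBounded : ∀ P ∈ PX, ∀ x y : X,
    IsDChain dist r {z | z ∈ P ∧ cP P z = 0} x y → dist x y ≤ 8 * fr

end TreeGradedColoring

section Arcs

variable {X : Type*} [MetricSpace X]

/-- `S` is a simple arc from `u` to `v`. -/
def IsArc (S : Set X) (u v : X) : Prop :=
  ∃ (f : ℝ → X) (a b : ℝ), a < b ∧ ContinuousOn f (Icc a b) ∧ InjOn f (Icc a b) ∧
    f a = u ∧ f b = v ∧ f '' Icc a b = S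

namespace IsArc

variable {S T : Set X} {u v w : X}

lemma left_mem (h : IsArc S u v) : u ∈ S := by
  obtain ⟨f, a, b, hab, -, -, rfl, -, rfl⟩ := h
  exact ⟨a, ⟨le_rfl, hab.le⟩, rfl⟩

lemma right_mem (h : IsArc S u v) : v ∈ S := by
  obtain ⟨f, a, b, hab, -, -, -, rfl, rfl⟩ := h
  exact ⟨b, ⟨hab.le, le_rfl⟩, rfl⟩

lemma ne (h : IsArc S u v) : u ≠ v := by
  obtain ⟨f, a, b, hab, -, hi, rfl, rfl, -⟩ := h
  intro h
  exact hab.ne (hi ⟨le_rfl, hab.le⟩ ⟨hab.le, le_rfl⟩ h)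

lemma isClosed (h : IsArc S u v) : IsClosed S := by
  obtain ⟨f, a, b, -, hc, -, -, -, rfl⟩ := h
  exact (isCompact_Icc.image_of_continuousOn hc).isClosed

lemma symm (h : IsArc S u v) : IsArc S v u := by
  obtain ⟨f, a, b, hab, hc, hi, rfl, rfl, rfl⟩ := h
  have hm : ∀ t ∈ Icc (-b) (-a), -t ∈ Icc a b := fun t ht => ⟨by linarith [ht.2], by linarith [ht.1]⟩
  refine ⟨fun t => f (-t), -b, -a, by linarith, hc.comp continuous_neg.continuousOn hm, ?_,
    by simp, by simp, ?_⟩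
  · intro s hs t ht hst
    exact neg_injective (hi (hm s hs) (hm t ht) hst)
  · ext x
    constructor
    · rintro ⟨t, ht, rfl⟩
      exact ⟨-t, hm t ht, rfl⟩
    · rintro ⟨t, ht, rfl⟩
      exact ⟨-t, ⟨by linarith [ht.2], by linarith [ht.1]⟩, by simp⟩

/-- An arc can be parametrized starting at any prescribed parameter. -/
lemma exists_param_from (h : IsArc S u v) (c : ℝ) :
    ∃ (f : ℝ → X) (d : ℝ), c < d ∧ ContinuousOn f (Icc c d) ∧ InjOn f (Icc c d) ∧
      f c = u ∧ f d = v ∧ f '' Icc c d = S := by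
  obtain ⟨f, a, b, hab, hc, hi, rfl, rfl, rfl⟩ := h
  have hm : ∀ t ∈ Icc c (c + (b - a)), t - c + a ∈ Icc a b :=
    fun t ht => ⟨by linarith [ht.1], by linarith [ht.2]⟩
  refine ⟨fun t => f (t - c + a), c + (b - a), by linarith,
    hc.comp (by fun_prop) hm, ?_, by simp, by ring_nf, ?_⟩
  · intro s hs t ht hst
    have := hi (hm s hs) (hm t ht) hst
    linarith
  · ext x
    constructor
    · rintro ⟨t, ht, rfl⟩
      exact ⟨_, hm t ht, rfl⟩
    · rintro ⟨t, ht, rfl⟩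
      exact ⟨t + c - a, ⟨by linarith [ht.1], by linarith [ht.2]⟩, by ring_nf⟩

/-- Concatenation of two arcs as a continuous parametrized path. -/
lemma exists_concat (hS : IsArc S u v) (hT : IsArc T v w) :
    ∃ (f : ℝ → X) (a b c : ℝ), a < b ∧ b < c ∧ ContinuousOn f (Icc a c) ∧
      InjOn f (Icc a b) ∧ InjOn f (Icc b c) ∧ f a = u ∧ f b = v ∧ f c = w ∧
      f '' Icc a b = S ∧ f '' Icc b c = T := by
  obtain ⟨f, a, b, hab, hc, hi, rfl, rfl, rfl⟩ := hS
  obtain ⟨g, d, hbd, gc, gi, hgb, rfl, rfl⟩ := hT.exists_param_from b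
  have e1 : EqOn (fun t => if t ≤ b then f t else g t) f (Icc a b) := by
    intro t ht
    simp [ht.2]
  have e2 : EqOn (fun t => if t ≤ b then f t else g t) g (Icc b d) := by
    intro t ht
    by_cases h : t ≤ b
    · have : t = b := le_antisymm h ht.1
      subst this
      simp [hgb]
    · simp [h]
  refine ⟨fun t => if t ≤ b then f t else g t, a, b, d, hab, hbd, ?_, hi.congr e1.symm,
    gi.congr e2.symm, e1 ⟨le_rfl, hab.le⟩, e1 ⟨hab.le, le_rfl⟩, e2 ⟨hbd.le, le_rfl⟩,
    e1.image_eq, e2.image_eq⟩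
  rw [← Icc_union_Icc_eq_Icc hab.le hbd.le]
  exact (hc.congr e1).union_of_isClosed (gc.congr e2) isClosed_Icc isClosed_Icc

lemma trans (hS : IsArc S u v) (hT : IsArc T v w) (hST : ∀ x ∈ S, x ∈ T → x = v) :
    IsArc (S ∪ T) u w := by
  obtain ⟨f, a, b, c, hab, hbc, hc, hi1, hi2, rfl, rfl, rfl, rfl, rfl⟩ := hS.exists_concat hT
  have key : ∀ s ∈ Icc a b, ∀ t ∈ Icc b c, f s = f t → s = t := by
    intro s hs t ht hst
    have h1 := hST (f s) ⟨s, hs, rfl⟩ ⟨t, ht, hst.symm⟩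
    have h2 : s = b := hi1 hs ⟨hab.le, le_rfl⟩ h1
    have h3 : t = b := hi2 ht ⟨le_rfl, hbc.le⟩ (hst ▸ h1)
    rw [h2, h3]
  refine ⟨f, a, c, hab.trans hbc, hc, ?_, rfl, rfl, ?_⟩
  · intro s hs t ht hst
    rcases le_total s b with h1 | h1 <;> rcases le_total t b with h2 | h2
    · exact hi1 ⟨hs.1, h1⟩ ⟨ht.1, h2⟩ hst
    · exact key s ⟨hs.1, h1⟩ t ⟨h2, ht.2⟩ hst
    · exact (key t ⟨ht.1, h2⟩ s ⟨h1, hs.2⟩ hst.symm).symm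
    · exact hi2 ⟨h1, hs.2⟩ ⟨h2, ht.2⟩ hst
  · rw [← Icc_union_Icc_eq_Icc hab.le hbc.le, image_union]

/-- The initial part of an arc up to the first point of a closed set. -/
lemma exists_first_hit (h : IsArc S u v) {C : Set X} (hC : IsClosed C) (hv : v ∈ C)
    (hu : u ∉ C) :
    ∃ w ∈ C, ∃ S' ⊆ S, IsArc S' u w ∧ ∀ x ∈ S', x ∈ C → x = w := by
  obtain ⟨f, a, b, hab, hc, hi, rfl, rfl, rfl⟩ := h
  have hcomp : IsCompact (Icc a b ∩ f ⁻¹' C) :=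
    isCompact_Icc.of_isClosed_subset (hc.preimage_isClosed_of_isClosed isClosed_Icc hC)
      inter_subset_left
  obtain ⟨t, ht, hmin⟩ := hcomp.exists_isLeast ⟨b, ⟨hab.le, le_rfl⟩, hv⟩
  have hat : a < t := lt_of_le_of_ne ht.1.1 (by rintro rfl; exact hu ht.2)
  have hsub : Icc a t ⊆ Icc a b := Icc_subset_Icc le_rfl ht.1.2
  refine ⟨f t, ht.2, f '' Icc a t, image_mono hsub,
    ⟨f, a, t, hat, hc.mono hsub, hi.mono hsub, rfl, rfl, rfl⟩, ?_⟩
  rintro _ ⟨s, hs, rfl⟩ hsC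
  rw [le_antisymm hs.2 (hmin ⟨hsub hs, hsC⟩)]

lemma exists_subarc (h : IsArc S u v) {x y : X} (hx : x ∈ S) (hy : y ∈ S) (hxy : x ≠ y) :
    ∃ S' ⊆ S, IsArc S' x y := by
  obtain ⟨f, a, b, hab, hc, hi, rfl, rfl, rfl⟩ := h
  obtain ⟨s, hs, rfl⟩ := hx
  obtain ⟨t, ht, rfl⟩ := hy
  have key : ∀ s ∈ Icc a b, ∀ t ∈ Icc a b, s < t → IsArc (f '' Icc s t) (f s) (f t) := by
    intro s hs t ht hst
    have hsub : Icc s t ⊆ Icc a b := Icc_subset_Icc hs.1 ht.2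
    exact ⟨f, s, t, hst, hc.mono hsub, hi.mono hsub, rfl, rfl, rfl⟩
  rcases lt_trichotomy s t with hst | rfl | hst
  · exact ⟨_, image_mono (Icc_subset_Icc hs.1 ht.2), key s hs t ht hst⟩
  · exact absurd rfl hxy
  · exact ⟨_, image_mono (Icc_subset_Icc ht.1 hs.2), (key t ht s hs hst).symm⟩

/-- Prolonging an arc by another one, after removing the superfluous parts. -/
lemma exists_prolong (hS : IsArc S u v) (hT : IsArc T v w) (huw : u ≠ w) :
    ∃ S' ⊆ S ∪ T, IsArc S' u w := by
  by_cases hu : u ∈ T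
  · obtain ⟨S', h1, h2⟩ := hT.exists_subarc hu hT.right_mem huw
    exact ⟨S', h1.trans subset_union_right, h2⟩
  obtain ⟨z, hz, S', hS', hA, hfirst⟩ := hS.exists_first_hit hT.isClosed hT.left_mem hu
  by_cases hzw : z = w
  · subst hzw
    exact ⟨S', hS'.trans subset_union_left, hA⟩
  obtain ⟨T', hT', hB⟩ := hT.exists_subarc hz hT.right_mem hzw
  exact ⟨S' ∪ T', union_subset_union hS' hT', hA.trans hB fun x h1 h2 => hfirst x h1 (hT' h2)⟩

end IsArc

/-- A loop made of two arcs lies in a piece. -/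
lemma IsTreeGraded.loop_subset {PX : Set (Set X)} (hT : IsTreeGraded X PX) {S T : Set X}
    {u v : X} (hS : IsArc S u v) (hT' : IsArc T v u) (hST : ∀ x ∈ S, x ∈ T → x = u ∨ x = v) :
    ∃ P ∈ PX, S ∪ T ⊆ P := by
  obtain ⟨f, a, b, c, hab, hbc, hc, hi1, hi2, rfl, rfl, hfc, rfl, rfl⟩ := hS.exists_concat hT'
  have hac : a < c := hab.trans hbc
  have key : ∀ s ∈ Ico a b, ∀ t ∈ Ico b c, f s = f t → s = t := by
    intro s hs t ht hst
    have hs' : s ∈ Icc a b := ⟨hs.1, hs.2.le⟩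
    have ht' : t ∈ Icc b c := ⟨ht.1, ht.2.le⟩
    rcases hST (f s) ⟨s, hs', rfl⟩ ⟨t, ht', hst.symm⟩ with h | h
    · have h3 : t = c := hi2 ht' ⟨hbc.le, le_rfl⟩ (by rw [← hst, h, hfc])
      exact absurd h3 ht.2.ne
    · exact absurd (hi1 hs' ⟨hab.le, le_rfl⟩ h) hs.2.ne
  have hinj : InjOn f (Ico a c) := by
    intro s hs t ht hst
    rcases lt_or_ge s b with h1 | h1 <;> rcases lt_or_ge t b with h2 | h2
    · exact hi1 ⟨hs.1, h1.le⟩ ⟨ht.1, h2.le⟩ hst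
    · exact key s ⟨hs.1, h1⟩ t ⟨h2, ht.2⟩ hst
    · exact (key t ⟨ht.1, h2⟩ s ⟨h1, hs.2⟩ hst.symm).symm
    · exact hi2 ⟨h1, hs.2.le⟩ ⟨h2, ht.2.le⟩ hst
  have hpos : 0 < c - a := sub_pos.2 hac
  let g : ℝ → X := fun t => f (a + t * (c - a))
  have hg01 : g 0 = g 1 := by simp [g, hfc]
  have hgc : ContinuousOn g (Icc 0 1) := by
    refine hc.comp (by fun_prop) ?_
    intro t ht
    exact ⟨by nlinarith [ht.1], by nlinarith [ht.2]⟩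
  have hinjg : InjOn g (Ico 0 1) := by
    intro s hs t ht hst
    have := hinj (x₁ := a + s * (c - a)) (x₂ := a + t * (c - a))
      ⟨by nlinarith [hs.1], by nlinarith [hs.2]⟩ ⟨by nlinarith [ht.1], by nlinarith [ht.2]⟩ hst
    have h2 : s * (c - a) = t * (c - a) := by linarith
    exact mul_right_cancel₀ hpos.ne' h2
  have hrep : ∀ q : AddCircle (1 : ℝ), ∃ t ∈ Ico (0 : ℝ) 1, (t : AddCircle (1 : ℝ)) = q := by
    intro q
    obtain ⟨t, ht⟩ := (AddCircle.equivIco (1 : ℝ) 0).symm.surjective q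
    refine ⟨t, by simpa using t.2, ?_⟩
    exact ht
  obtain ⟨P, hP, hsub⟩ := hT.t2 (AddCircle.liftIco 1 0 g)
    (AddCircle.liftIco_zero_continuous hg01 hgc) (by
      intro q1 q2 h
      obtain ⟨s, hs, rfl⟩ := hrep q1
      obtain ⟨t, ht, rfl⟩ := hrep q2
      rw [AddCircle.liftIco_zero_coe_apply hs, AddCircle.liftIco_zero_coe_apply ht] at h
      rw [hinjg hs ht h])
  have hmem : ∀ s ∈ Ico a c, f s ∈ P := by
    intro s hs
    have ht : (s - a) / (c - a) ∈ Ico (0 : ℝ) 1 :=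
      ⟨div_nonneg (by linarith [hs.1]) hpos.le, (div_lt_one hpos).2 (by linarith [hs.2])⟩
    refine hsub ⟨(((s - a) / (c - a) : ℝ) : AddCircle (1 : ℝ)), ?_⟩
    rw [AddCircle.liftIco_zero_coe_apply ht]
    simp only [g]
    congr 1
    field_simp
    ring
  refine ⟨P, hP, ?_⟩
  have hall : ∀ s ∈ Icc a c, f s ∈ P := by
    intro s hs
    rcases eq_or_lt_of_le hs.2 with h | h
    · rw [h, hfc]; exact hmem a ⟨le_rfl, hac⟩
    · exact hmem s ⟨hs.1, h⟩
  rintro x (⟨s, hs, rfl⟩ | ⟨s, hs, rfl⟩)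
  · exact hall s ⟨hs.1, hs.2.trans hbc.le⟩
  · exact hall s ⟨hab.le.trans hs.1, hs.2⟩

namespace IsGeodesicSegment

variable {γ : ℝ → X} {a b : ℝ}

lemma mono (h : IsGeodesicSegment γ a b) {a' b' : ℝ} (ha : a ≤ a') (hb : b' ≤ b) :
    IsGeodesicSegment γ a' b' :=
  fun s hs t ht => h s ⟨ha.trans hs.1, hs.2.trans hb⟩ t ⟨ha.trans ht.1, ht.2.trans hb⟩

lemma continuousOn (h : IsGeodesicSegment γ a b) : ContinuousOn γ (Icc a b) := by
  refine LipschitzOnWith.continuousOn (K := 1) (LipschitzOnWith.of_dist_le_mul ?_)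
  intro s hs t ht
  rw [h s hs t ht, Real.dist_eq]
  simp

lemma injOn (h : IsGeodesicSegment γ a b) : InjOn γ (Icc a b) := by
  intro s hs t ht hst
  have := h s hs t ht
  rw [hst, dist_self] at this
  linarith [abs_eq_zero.1 this.symm]

lemma isArc (h : IsGeodesicSegment γ a b) (hab : a < b) : IsArc (γ '' Icc a b) (γ a) (γ b) :=
  ⟨γ, a, b, hab, h.continuousOn, h.injOn, rfl, rfl, rfl⟩

lemma dist_of_le (h : IsGeodesicSegment γ a b) {s t : ℝ} (h1 : a ≤ s) (h2 : s ≤ t)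
    (h3 : t ≤ b) : dist (γ s) (γ t) = t - s := by
  rw [h s ⟨h1, h2.trans h3⟩ t ⟨h1.trans h2, h3⟩, abs_sub_comm, abs_of_nonneg (by linarith)]

lemma reverse (h : IsGeodesicSegment γ a b) :
    IsGeodesicSegment (fun t => γ (a + b - t)) a b := by
  intro s hs t ht
  rw [h _ ⟨by linarith [hs.2], by linarith [hs.1]⟩ _ ⟨by linarith [ht.2], by linarith [ht.1]⟩,
    abs_sub_comm]
  congr 1
  ring

end IsGeodesicSegment

/-- An arc meeting a piece exactly at its endpoints is contained in this piece. -/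
lemma IsTreeGraded.arc_subset {PX : Set (Set X)} (hT : IsTreeGraded X PX) {P : Set X}
    (hP : P ∈ PX) {S : Set X} {u v : X} (hS : IsArc S u v) (hu : u ∈ P) (hv : v ∈ P)
    (hSP : ∀ x ∈ S, x ∈ P → x = u ∨ x = v) : S ⊆ P := by
  obtain ⟨γ, hγ, h0, h1, hsub⟩ := hT.geodesicSub P hP v hv u hu
  have hA : IsArc (γ '' Icc 0 (dist v u)) v u := by
    have := hγ.isArc (dist_pos.2 hS.ne.symm)
    rwa [h0, h1] at this
  have hAP : γ '' Icc 0 (dist v u) ⊆ P := by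
    rintro _ ⟨t, ht, rfl⟩
    exact hsub t ht
  obtain ⟨Q, hQ, hQs⟩ := hT.loop_subset hS hA fun x h1 h2 => hSP x h1 (hAP h2)
  have : P = Q := by
    by_contra hne
    exact hS.ne (hT.t1 P hP Q hQ hne ⟨hu, hQs (Or.inl hS.left_mem)⟩
      ⟨hv, hQs (Or.inl hS.right_mem)⟩)
  rw [this]
  exact subset_union_left.trans hQs

end Arcs

section Projections

variable {X : Type*} [MetricSpace X] {PX : Set (Set X)} {n : ℕ} {r fr : ℝ} {xhat : X}
  {proj : Set X → X → X} {cP : Set X → X → Fin (n + 1)}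

namespace ColoringSetup

variable {P Q : Set X} {x y q : X}

lemma dist_proj_le (H : ColoringSetup X PX n r fr xhat proj cP) (hP : P ∈ PX) (hq : q ∈ P) :
    dist x (proj P x) ≤ dist x q := by
  rw [H.projDist P hP x]
  exact infDist_le_dist_of_mem hq

lemma proj_self (H : ColoringSetup X PX n r fr xhat proj cP) (hP : P ∈ PX) (hq : q ∈ P) :
    proj P q = q := by
  have h := H.dist_proj_le (x := q) hP hq
  rw [dist_self] at h
  exact (dist_le_zero.1 h).symm

lemma eq_proj_of_dist_add_eq (H : ColoringSetup X PX n r fr xhat proj cP) (hP : P ∈ PX)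
    {g : X} (hg : dist x g + dist g (proj P x) = dist x (proj P x)) (hgP : g ∈ P) :
    g = proj P x := by
  have h := H.dist_proj_le (x := x) hP hgP
  exact dist_le_zero.1 (by linarith)

/-- A geodesic ending in a piece passes through the projection of its origin. -/
lemma exists_eq_proj (H : ColoringSetup X PX n r fr xhat proj cP) (hP : P ∈ PX)
    {γ : ℝ → X} {a b : ℝ} (hab : a ≤ b) (hγ : IsGeodesicSegment γ a b) (hb : γ b ∈ P) :
    ∃ t ∈ Icc a b, γ t = proj P (γ a) := by
  by_contra hcon
  push Not at hcon
  have hpP := H.projMem P hP (γ a)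
  set p := proj P (γ a) with hp
  have haP : γ a ∉ P := fun h => hcon a ⟨le_rfl, hab⟩ (H.proj_self hP h).symm
  have hab' : a < b := lt_of_le_of_ne hab (by rintro rfl; exact haP hb)
  obtain ⟨q, hq, S, hS, hA, hfirst⟩ :=
    (hγ.isArc hab').exists_first_hit (H.treeGraded.closed P hP) hb haP
  have hpS : p ∉ S := fun h => by
    obtain ⟨t, ht, h⟩ := hS h
    exact hcon t ht h
  have hap : γ a ≠ p := fun h => haP (h ▸ hpP)
  obtain ⟨δ, hδ, d0, d1⟩ := H.geodesic (γ a) p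
  have hG : IsArc (δ '' Icc 0 (dist (γ a) p)) (γ a) p := by
    have := hδ.isArc (dist_pos.2 hap)
    rwa [d0, d1] at this
  have hGP : ∀ x ∈ δ '' Icc 0 (dist (γ a) p), x ∈ P → x = p := by
    rintro _ ⟨t, ht, rfl⟩ hx
    refine H.eq_proj_of_dist_add_eq hP ?_ hx
    have h1 := hδ.dist_of_le le_rfl ht.1 ht.2
    have h2 := hδ.dist_of_le ht.1 ht.2 le_rfl
    rw [d0] at h1
    rw [d1] at h2
    rw [← hp]
    linarith
  obtain ⟨z, hz, S₁, hS₁, hA₁, hfirst₁⟩ :=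
    hG.symm.exists_first_hit hA.isClosed hA.left_mem hpS
  by_cases hzq : z = q
  · subst hzq
    exact hpS (hGP z (hS₁ hA₁.right_mem) hq ▸ hz)
  obtain ⟨S₂, hS₂, hA₂⟩ := hA.exists_subarc hz hA.right_mem hzq
  have hB := hA₁.trans hA₂ fun x h1 h2 => hfirst₁ x h1 (hS₂ h2)
  have hsub := H.treeGraded.arc_subset hP hB hpP hq (by
    rintro x (h | h) hx
    · exact Or.inl (hGP x (hS₁ h) hx)
    · exact Or.inr (hfirst x (hS₂ h) hx))
  exact hzq (hfirst z hz (hsub (Or.inl hA₁.right_mem)))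

lemma dist_eq_of_mem (H : ColoringSetup X PX n r fr xhat proj cP) (hP : P ∈ PX) (hq : q ∈ P)
    (x : X) : dist x q = dist x (proj P x) + dist (proj P x) q := by
  obtain ⟨γ, hγ, h0, h1⟩ := H.geodesic x q
  obtain ⟨t, ht, h⟩ := H.exists_eq_proj hP dist_nonneg hγ (h1.symm ▸ hq)
  rw [h0] at h
  have e1 := hγ.dist_of_le le_rfl ht.1 ht.2
  have e2 := hγ.dist_of_le ht.1 ht.2 le_rfl
  rw [h0, h] at e1
  rw [h1, h] at e2
  linarith

/-- Pieces are convex. -/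
lemma mem_of_dist_add_eq (H : ColoringSetup X PX n r fr xhat proj cP) (hP : P ∈ PX)
    (hx : x ∈ P) (hy : y ∈ P) {z : X} (hz : dist x z + dist z y = dist x y) : z ∈ P := by
  have h1 := H.dist_eq_of_mem hP hx z
  have h2 := H.dist_eq_of_mem hP hy z
  have h3 := dist_triangle x (proj P z) y
  rw [dist_comm z x] at h1
  rw [dist_comm (proj P z) x] at h1
  have h4 : dist z (proj P z) ≤ 0 := by linarith
  rw [dist_le_zero.1 h4]
  exact H.projMem P hP z

lemma proj_eq_of_dist_add_eq (H : ColoringSetup X PX n r fr xhat proj cP) (hP : P ∈ PX)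
    {z : X} (hz : dist x z + dist z (proj P x) = dist x (proj P x)) : proj P z = proj P x := by
  have h1 := H.dist_eq_of_mem hP (H.projMem P hP x) z
  have h2 := H.dist_proj_le (x := x) hP (H.projMem P hP z)
  have h3 := dist_triangle x z (proj P z)
  exact dist_le_zero.1 (by linarith)

/-- A geodesic avoiding a piece has a constant projection to this piece. -/
lemma exists_mem_of_proj_ne (H : ColoringSetup X PX n r fr xhat proj cP) (hP : P ∈ PX)
    {γ : ℝ → X} {a b : ℝ} (hab : a ≤ b) (hγ : IsGeodesicSegment γ a b)
    (hne : proj P (γ a) ≠ proj P (γ b)) : ∃ t ∈ Icc a b, γ t ∈ P := by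
  by_contra hcon
  push Not at hcon
  have hab' : a < b := lt_of_le_of_ne hab (by rintro rfl; exact hne rfl)
  have hI := hγ.isArc hab'
  have hIP : ∀ x ∈ γ '' Icc a b, x ∉ P := by
    rintro _ ⟨t, ht, rfl⟩
    exact hcon t ht
  set I := γ '' Icc a b
  have key : ∀ x ∈ I, ∃ z ∈ I, ∃ S, IsArc S (proj P x) z ∧
      (∀ w ∈ S, w ∈ I → w = z) ∧ (∀ w ∈ S, w ∈ P → w = proj P x) ∧
      ∀ w ∈ S, proj P w = proj P x := by
    intro x hx
    have hpP := H.projMem P hP x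
    have hpI : proj P x ∉ I := fun h => hIP _ h hpP
    have hxp : x ≠ proj P x := fun h => hpI (h ▸ hx)
    obtain ⟨δ, hδ, d0, d1⟩ := H.geodesic x (proj P x)
    have hG : IsArc (δ '' Icc 0 (dist x (proj P x))) x (proj P x) := by
      have := hδ.isArc (dist_pos.2 hxp)
      rwa [d0, d1] at this
    have hGd : ∀ w ∈ δ '' Icc 0 (dist x (proj P x)),
        dist x w + dist w (proj P x) = dist x (proj P x) := by
      rintro _ ⟨t, ht, rfl⟩
      have h1 := hδ.dist_of_le le_rfl ht.1 ht.2
      have h2 := hδ.dist_of_le ht.1 ht.2 le_rfl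
      rw [d0] at h1
      rw [d1] at h2
      linarith
    obtain ⟨z, hz, S, hS, hA, hf⟩ := hG.symm.exists_first_hit hI.isClosed hx hpI
    exact ⟨z, hz, S, hA, hf, fun w hw hwP => H.eq_proj_of_dist_add_eq hP (hGd w (hS hw)) hwP,
      fun w hw => H.proj_eq_of_dist_add_eq hP (hGd w (hS hw))⟩
  obtain ⟨z, hz, A, hA, hA1, hA2, hA3⟩ := key _ hI.left_mem
  obtain ⟨w, hw, B, hB, hB1, hB2, hB3⟩ := key _ hI.right_mem
  have hdisj : ∀ v ∈ A, v ∉ B := fun v h1 h2 => hne ((hA3 v h1).symm.trans (hB3 v h2))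
  have hzw : z ≠ w := by
    rintro rfl
    exact hdisj _ hA.right_mem hB.right_mem
  obtain ⟨J, hJ, hC⟩ := hI.exists_subarc hz hw hzw
  have h1 := hA.trans hC fun v hv hv' => hA1 v hv (hJ hv')
  have h2 := h1.trans hB.symm (by
    rintro v (hv | hv) hv'
    · exact absurd hv' (hdisj v hv)
    · exact hB1 v hv' (hJ hv))
  have h3 := H.treeGraded.arc_subset hP h2 (H.projMem P hP _) (H.projMem P hP _) (by
    rintro v ((hv | hv) | hv) hvP
    · exact Or.inl (hA2 v hv hvP)
    · exact absurd hvP (hIP v (hJ hv))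
    · exact Or.inr (hB2 v hv hvP))
  exact hIP z hz (h3 (Or.inl (Or.inl hA.right_mem)))

lemma dist_eq_of_proj_ne (H : ColoringSetup X PX n r fr xhat proj cP) (hP : P ∈ PX)
    (hne : proj P x ≠ proj P y) :
    dist x y = dist x (proj P x) + dist (proj P x) (proj P y) + dist (proj P y) y := by
  obtain ⟨γ, hγ, h0, h1⟩ := H.geodesic x y
  obtain ⟨t, ht, h⟩ := H.exists_mem_of_proj_ne hP dist_nonneg hγ (by rwa [h0, h1])
  have e1 := hγ.dist_of_le le_rfl ht.1 ht.2
  have e2 := hγ.dist_of_le ht.1 ht.2 le_rfl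
  rw [h0] at e1
  rw [h1] at e2
  have h2 := H.dist_eq_of_mem hP h x
  have h3 := H.dist_eq_of_mem hP h y
  have h4 := dist_triangle (proj P x) (γ t) (proj P y)
  have h5 := dist_triangle4 x (proj P x) (proj P y) y
  rw [dist_comm y (γ t), dist_comm y, dist_comm (proj P y) (γ t)] at h3
  linarith

lemma dist_proj_proj_le (H : ColoringSetup X PX n r fr xhat proj cP) (hP : P ∈ PX) (x y : X) :
    dist (proj P x) (proj P y) ≤ dist x y := by
  by_cases h : proj P x = proj P y
  · rw [h, dist_self]; exact dist_nonneg
  · rw [H.dist_eq_of_proj_ne hP h]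
    linarith [dist_nonneg (x := x) (y := proj P x), dist_nonneg (x := proj P y) (y := y)]

/-- The projection of a piece to another piece is a single point. -/
lemma proj_eq_of_mem_piece (H : ColoringSetup X PX n r fr xhat proj cP) (hP : P ∈ PX)
    (hQ : Q ∈ PX) (hPQ : P ≠ Q) (hx : x ∈ Q) (hy : y ∈ Q) : proj P x = proj P y := by
  by_contra hne
  have h := H.dist_eq_of_proj_ne hP hne
  have h1 := dist_triangle x (proj P x) y
  have h2 := dist_triangle (proj P x) (proj P y) y
  have h3 := dist_triangle x (proj P x) (proj P y)
  have h4 := dist_triangle x (proj P y) y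
  refine hne (H.treeGraded.t1 P hP Q hQ hPQ ⟨H.projMem P hP x, ?_⟩ ⟨H.projMem P hP y, ?_⟩)
  · exact H.mem_of_dist_add_eq hQ hx hy (by linarith)
  · exact H.mem_of_dist_add_eq hQ hx hy (by linarith)

lemma dist_base_eq (H : ColoringSetup X PX n r fr xhat proj cP) (hP : P ∈ PX) (hq : q ∈ P) :
    dist xhat q = dist xhat (proj P xhat) + dist (proj P xhat) q :=
  H.dist_eq_of_mem hP hq xhat

lemma dist_eq_of_proj_ne_base (H : ColoringSetup X PX n r fr xhat proj cP) (hP : P ∈ PX)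
    (hne : proj P x ≠ proj P xhat) :
    dist xhat x = dist xhat (proj P x) + dist (proj P x) x := by
  rw [H.dist_eq_of_proj_ne hP hne.symm, H.dist_base_eq hP (H.projMem P hP x)]

/-- Of two different pieces, one is projected to the base point of the other. -/
lemma base_eq_or_base_eq (H : ColoringSetup X PX n r fr xhat proj cP) (hP : P ∈ PX)
    (hQ : Q ∈ PX) (hPQ : P ≠ Q) :
    (∀ q ∈ Q, proj P q = proj P xhat) ∨ (∀ p ∈ P, proj Q p = proj Q xhat) := by
  by_cases h : proj P (proj Q xhat) = proj P xhat
  · left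
    intro q hq
    rw [← h]
    exact H.proj_eq_of_mem_piece hP hQ hPQ hq (H.projMem Q hQ xhat)
  · right
    intro p hp
    rw [H.proj_eq_of_mem_piece hQ hP hPQ.symm hp (H.projMem P hP xhat)]
    by_contra h2
    have e1 := H.dist_eq_of_proj_ne hP (Ne.symm h)
    have e2 := H.dist_eq_of_proj_ne hQ (Ne.symm h2)
    have p1 := dist_pos.2 h
    have n1 := dist_nonneg (x := proj P (proj Q xhat)) (y := proj Q xhat)
    have n2 := dist_nonneg (x := proj Q xhat) (y := proj Q (proj P xhat))
    have n3 := dist_nonneg (x := proj Q (proj P xhat)) (y := proj P xhat)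
    rw [dist_comm] at p1
    linarith

/-- If the piece `P` is projected to the base point of `Q` and `x` is beyond `Q`, then `P`
comes before `Q` on the way from the base point to `x`. -/
lemma before_of_proj_eq (H : ColoringSetup X PX n r fr xhat proj cP) (hP : P ∈ PX)
    (hQ : Q ∈ PX) (hx : proj P x ≠ proj P xhat) (hx' : proj Q x ≠ proj Q xhat)
    (h : ∀ p ∈ P, proj Q p = proj Q xhat) :
    dist xhat (proj P x) ≤ dist xhat (proj Q xhat) ∧ proj P (proj Q xhat) = proj P x := by
  have e0 := h _ (H.projMem P hP x)
  have e1 := H.dist_eq_of_proj_ne (x := proj P x) (y := x) hQ (by rw [e0]; exact hx'.symm)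
  rw [e0] at e1
  have e2 := H.dist_eq_of_proj_ne_base hP hx
  have e3 := H.dist_eq_of_proj_ne_base hQ hx'
  have e4 := H.dist_base_eq hQ (H.projMem Q hQ x)
  have n1 := dist_nonneg (x := proj P x) (y := proj Q xhat)
  refine ⟨by linarith, ?_⟩
  by_contra h5
  have e5 := H.dist_eq_of_proj_ne hP h5
  have e6 := dist_triangle (proj Q xhat) (proj Q x) x
  have p1 := dist_pos.2 h5
  have n2 := dist_nonneg (x := proj Q xhat) (y := proj P (proj Q xhat))
  linarith

lemma before_or_before (H : ColoringSetup X PX n r fr xhat proj cP) (hP : P ∈ PX)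
    (hQ : Q ∈ PX) (hPQ : P ≠ Q) (hx : proj P x ≠ proj P xhat) (hx' : proj Q x ≠ proj Q xhat) :
    (dist xhat (proj P x) ≤ dist xhat (proj Q xhat) ∧ proj P (proj Q xhat) = proj P x) ∨
    (dist xhat (proj Q x) ≤ dist xhat (proj P xhat) ∧ proj Q (proj P xhat) = proj Q x) := by
  rcases H.base_eq_or_base_eq hP hQ hPQ with h | h
  · exact Or.inr (H.before_of_proj_eq hQ hP hx' hx h)
  · exact Or.inl (H.before_of_proj_eq hP hQ hx hx' h)

lemma proj_eq_proj_base (H : ColoringSetup X PX n r fr xhat proj cP) (hP : P ∈ PX)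
    (hQ : Q ∈ PX) (hPQ : P ≠ Q) (hx : proj Q x ≠ proj Q xhat)
    (h : proj P (proj Q xhat) ≠ proj P xhat) : proj P x = proj P (proj Q xhat) := by
  rcases H.base_eq_or_base_eq hP hQ hPQ with h1 | h1
  · exact absurd (h1 _ (H.projMem Q hQ xhat)) h
  by_contra h2
  have e0 := H.proj_eq_of_mem_piece hP hQ hPQ (H.projMem Q hQ x) (H.projMem Q hQ xhat)
  have e1 := H.dist_eq_of_proj_ne (x := proj Q x) (y := x) hP (by rw [e0]; exact Ne.symm h2)
  rw [e0] at e1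
  have e2 := H.dist_eq_of_proj_ne_base hP h
  have e3 := H.dist_eq_of_proj_ne_base hQ hx
  have e4 := H.dist_base_eq hQ (H.projMem Q hQ x)
  have p1 := dist_pos.2 hx
  rw [dist_comm] at p1
  have t1 := dist_triangle xhat (proj P (proj Q xhat)) x
  have t2 := dist_triangle (proj P (proj Q xhat)) (proj P x) x
  have n1 := dist_nonneg (x := proj Q x) (y := proj P (proj Q xhat))
  have n2 := dist_nonneg (x := proj P (proj Q xhat)) (y := proj Q xhat)
  linarith

/-- At most one projection changes deeply at a step of length less than `r`. -/
lemma shallow_or_shallow (H : ColoringSetup X PX n r fr xhat proj cP) (hP : P ∈ PX)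
    (hQ : Q ∈ PX) (hPQ : P ≠ Q) (hxy : dist x y < r) (hPx : proj P x ≠ proj P y)
    (hQx : proj Q x ≠ proj Q y) :
    (dist (proj P xhat) (proj P x) < r ∧ dist (proj P xhat) (proj P y) < r) ∨
    (dist (proj Q xhat) (proj Q x) < r ∧ dist (proj Q xhat) (proj Q y) < r) := by
  have key : ∀ P ∈ PX, ∀ Q ∈ PX, proj P x ≠ proj P y → proj Q x ≠ proj Q y →
      (∀ q ∈ Q, proj P q = proj P xhat) →
      dist (proj P xhat) (proj P x) < r ∧ dist (proj P xhat) (proj P y) < r := by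
    intro P hP Q hQ hPx hQx h
    have e := H.dist_eq_of_proj_ne hQ hQx
    have h1 := h _ (H.projMem Q hQ x)
    have l1 := H.dist_proj_proj_le hP (proj Q x) x
    have l2 := H.dist_proj_proj_le hP (proj Q x) y
    have t2 := dist_triangle (proj Q x) (proj Q y) y
    rw [h1] at l1 l2
    rw [dist_comm (proj Q x) x] at l1
    have n1 := dist_nonneg (x := proj Q x) (y := proj Q y)
    have n2 := dist_nonneg (x := proj Q y) (y := y)
    have n3 := dist_nonneg (x := x) (y := proj Q x)
    constructor <;> linarith
  rcases H.base_eq_or_base_eq hP hQ hPQ with h | h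
  · exact Or.inl (key P hP Q hQ hPx hQx h)
  · exact Or.inr (key Q hQ P hP hQx hPx h)

end ColoringSetup

end Projections

section Branching

variable {X : Type*} [MetricSpace X] {PX : Set (Set X)} {n : ℕ} {r fr : ℝ} {xhat : X}
  {proj : Set X → X → X} {cP : Set X → X → Fin (n + 1)}

/-- A chain with small steps which is far from `u` can be replaced by an arc avoiding `u`. -/
lemma exists_isArc_notMem_of_chain (hX : GeodesicSpace X) {u : X} {c : ℕ → X} :
    ∀ m : ℕ, (∀ i < m, dist (c i) (c (i + 1)) < r) → (∀ i ≤ m, r ≤ dist (c i) u) → c 0 ≠ u →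
      c 0 ≠ c m → ∃ S, IsArc S (c 0) (c m) ∧ u ∉ S := by
  intro m
  induction m with
  | zero => intro _ _ _ h; exact absurd rfl h
  | succ m ih =>
    intro hstep hfar hu hne
    have hG : c m ≠ c (m + 1) → ∃ S, IsArc S (c m) (c (m + 1)) ∧ u ∉ S := by
      intro hm
      obtain ⟨γ, hγ, h0, h1⟩ := hX (c m) (c (m + 1))
      refine ⟨γ '' Icc 0 (dist (c m) (c (m + 1))), ?_, ?_⟩
      · have := hγ.isArc (dist_pos.2 hm)
        rwa [h0, h1] at this
      · rintro ⟨t, ht, hu⟩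
        have e := hγ.dist_of_le le_rfl ht.1 ht.2
        rw [h0, hu] at e
        linarith [hfar m m.le_succ, hstep m m.lt_succ_self, ht.2]
    by_cases h0 : c 0 = c m
    · rw [h0] at hne ⊢
      exact hG hne
    obtain ⟨S, hS, huS⟩ := ih (fun i hi => hstep i (by omega)) (fun i hi => hfar i (by omega)) hu h0
    by_cases hm : c m = c (m + 1)
    · exact ⟨S, hm ▸ hS, huS⟩
    obtain ⟨T, hT, huT⟩ := hG hm
    obtain ⟨S', hS', hA⟩ := hS.exists_prolong hT hne
    exact ⟨S', hA, fun h => (hS' h).elim huS huT⟩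

lemma exists_step_of_ne {α : Type*} {g : ℕ → α} {m : ℕ} (h : g 0 ≠ g m) :
    ∃ i < m, g i = g 0 ∧ g (i + 1) ≠ g 0 := by
  by_contra hcon
  push Not at hcon
  have : ∀ i ≤ m, g i = g 0 := by
    intro i
    induction i with
    | zero => intro _; rfl
    | succ i ih => intro hi; exact hcon i (by omega) (ih (by omega))
  exact h (this m le_rfl).symm

/-- The first and the last points of a chain branch, as seen from `a`, at a point or in a piece
close to the chain. -/
lemma ColoringSetup.exists_branching (H : ColoringSetup X PX n r fr xhat proj cP) (a : X)
    {c : ℕ → X} {m : ℕ} (hstep : ∀ i < m, dist (c i) (c (i + 1)) < r) :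
    ∃ p q : X, dist a p + dist p (c 0) = dist a (c 0) ∧
      dist a q + dist q (c m) = dist a (c m) ∧
      (∃ i ≤ m, dist (c i) p < r) ∧ (∃ i ≤ m, dist (c i) q < r) ∧
      (p = q ∨ ∃ P ∈ PX, p = proj P (c 0) ∧ q = proj P (c m) ∧ p ≠ a ∧ q ≠ a) := by
  by_cases hxx : c 0 = c m
  · exact ⟨c 0, c 0, by simp, by simp [hxx], ⟨0, by simp, by simpa using H.rpos⟩,
      ⟨0, by simp, by simpa using H.rpos⟩, Or.inl rfl⟩
  obtain ⟨γ, hγ, g0, g1⟩ := H.geodesic a (c 0)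
  have hγc := hγ.continuousOn
  set ℓ := dist a (c 0) with hℓ
  have hℓ0 : 0 ≤ ℓ := dist_nonneg
  have hT : IsCompact {t | t ∈ Icc 0 ℓ ∧ dist a (γ t) + dist (γ t) (c m) = dist a (c m)} := by
    have h1 : ContinuousOn (fun t => dist a (γ t) + dist (γ t) (c m)) (Icc 0 ℓ) := by fun_prop
    exact isCompact_Icc.of_isClosed_subset
      (h1.preimage_isClosed_of_isClosed isClosed_Icc (isClosed_singleton (x := dist a (c m))))
      inter_subset_left
  obtain ⟨t₀, ⟨ht₀, hu⟩, hmax⟩ := hT.exists_isGreatest ⟨0, ⟨le_rfl, hℓ0⟩, by simp [g0]⟩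
  have hux := hγ.dist_of_le le_rfl ht₀.1 ht₀.2
  have hux' := hγ.dist_of_le ht₀.1 ht₀.2 le_rfl
  rw [g0] at hux
  rw [g1] at hux'
  set u := γ t₀ with hu_def
  by_cases hclose : ∃ i ≤ m, dist (c i) u < r
  · exact ⟨u, u, by linarith, hu, hclose, hclose, Or.inl rfl⟩
  push Not at hclose
  have hr := H.rpos
  have hne0 : u ≠ c 0 := by
    intro h
    have := hclose 0 (Nat.zero_le _)
    rw [h, dist_self] at this
    linarith
  have hnem : u ≠ c m := by
    intro h
    have := hclose m le_rfl
    rw [h, dist_self] at this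
    linarith
  obtain ⟨S, hS, huS⟩ := exists_isArc_notMem_of_chain H.geodesic m hstep hclose hne0.symm hxx
  have ht₀ℓ : t₀ < ℓ := lt_of_le_of_ne ht₀.2 (by rintro h; exact hne0 (by rw [hu_def, h, g1]))
  have hα := (hγ.mono ht₀.1 le_rfl).isArc ht₀ℓ
  rw [g1] at hα
  -- a point of the first geodesic beyond `u` is not on the way from `u` to `c m`
  have hlast : ∀ t ∈ Icc t₀ ℓ, dist u (γ t) + dist (γ t) (c m) = dist u (c m) → γ t = u := by
    intro t ht h
    have h1 := dist_triangle a u (γ t)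
    have h2 := dist_triangle a (γ t) (c m)
    have h3 : t ≤ t₀ := hmax ⟨⟨ht₀.1.trans ht.1, ht.2⟩, by linarith⟩
    rw [hu_def, le_antisymm h3 ht.1]
  obtain ⟨δ, hδ, d0, d1⟩ := H.geodesic u (c m)
  have hβ : IsArc (δ '' Icc 0 (dist u (c m))) u (c m) := by
    have := hδ.isArc (dist_pos.2 hnem)
    rwa [d0, d1] at this
  have hβd : ∀ w ∈ δ '' Icc 0 (dist u (c m)), dist u w + dist w (c m) = dist u (c m) := by
    rintro _ ⟨t, ht, rfl⟩
    have h1 := hδ.dist_of_le le_rfl ht.1 ht.2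
    have h2 := hδ.dist_of_le ht.1 ht.2 le_rfl
    rw [d0] at h1
    rw [d1] at h2
    linarith
  have hαd : ∀ w ∈ γ '' Icc t₀ ℓ, dist u w + dist w (c 0) = dist u (c 0) := by
    rintro _ ⟨t, ht, rfl⟩
    have h1 := hγ.dist_of_le ht₀.1 ht.1 ht.2
    have h2 := hγ.dist_of_le (ht₀.1.trans ht.1) ht.2 le_rfl
    rw [g1] at h2
    rw [← hu_def] at h1
    linarith
  obtain ⟨z, hz, A, hAs, hA, hAf⟩ := hα.exists_first_hit hS.isClosed hS.left_mem huS
  obtain ⟨w, hw, B, hBs, hB, hBf⟩ := hβ.exists_first_hit hS.isClosed hS.right_mem huS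
  have hAB : ∀ v ∈ A, v ∈ B → v = u := by
    intro v h1 h2
    obtain ⟨t, ht, rfl⟩ := hAs h1
    exact hlast t ht (hβd _ (hBs h2))
  have hzw : z ≠ w := by
    intro h
    exact huS (hAB z hA.right_mem (h ▸ hB.right_mem) ▸ hz)
  obtain ⟨J, hJ, hC⟩ := hS.exists_subarc hz hw hzw
  obtain ⟨P, hP, hsub⟩ := H.treeGraded.loop_subset
    (hA.trans hC fun v h1 h2 => hAf v h1 (hJ h2)) hB.symm (by
      rintro v (hv | hv) hv'
      · exact Or.inl (hAB v hv hv')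
      · exact Or.inr (hBf v hv' (hJ hv)))
  have huP : u ∈ P := hsub (Or.inl (Or.inl hA.left_mem))
  have hzP : z ∈ P := hsub (Or.inl (Or.inl hA.right_mem))
  have hwP : w ∈ P := hsub (Or.inr hB.right_mem)
  have hproj : ∀ x z : X, z ∈ P → z ≠ u → dist u z + dist z x = dist u x → proj P x ≠ u := by
    intro x z hzP hzu h1 h2
    have h3 := H.dist_eq_of_mem hP hzP x
    rw [h2, dist_comm x z, dist_comm x u] at h3
    have := dist_pos.2 hzu
    rw [dist_comm] at this
    linarith
  have hpu := hproj (c 0) z hzP (fun h => huS (h ▸ hz)) (hαd z (hAs hA.right_mem))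
  have hqu := hproj (c m) w hwP (fun h => huS (h ▸ hw)) (hβd w (hBs hB.right_mem))
  have hpd := H.dist_eq_of_mem hP huP (c 0)
  have hqd := H.dist_eq_of_mem hP huP (c m)
  have hpq : proj P (c 0) ≠ proj P (c m) := by
    intro h
    have hrev := (hγ.mono ht₀.1 le_rfl).reverse
    obtain ⟨t, ht, htp⟩ := H.exists_eq_proj hP ht₀ℓ.le hrev (by simpa using huP)
    simp only [add_sub_cancel_left, g1] at htp
    refine hpu (htp ▸ hlast (t₀ + ℓ - t) ⟨by linarith [ht.2], by linarith [ht.1]⟩ ?_)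
    rw [htp, h, dist_comm, dist_comm _ (c m), dist_comm u (c m)]
    linarith
  have hbt : ∀ x p : X, dist x u = dist x p + dist p u → dist a u + dist u x = dist a x →
      dist a p + dist p x = dist a x := by
    intro x p h1 h2
    have h3 := dist_triangle a u p
    have h4 := dist_triangle a p x
    rw [dist_comm x u, dist_comm x p, dist_comm p u] at h1
    linarith
  have hna : ∀ x p : X, p ≠ u → dist x u = dist x p + dist p u →
      dist a u + dist u x = dist a x → p ≠ a := by
    rintro x p h0 h1 h2 rfl
    have h3 := dist_pos.2 h0
    rw [dist_comm x u, dist_comm x p] at h1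
    linarith
  refine ⟨proj P (c 0), proj P (c m), hbt _ _ hpd (by linarith), hbt _ _ hqd hu, ?_, ?_,
    Or.inr ⟨P, hP, rfl, rfl, hna _ _ hpu hpd (by linarith), hna _ _ hqu hqd hu⟩⟩
  · obtain ⟨i, hi, h1, h2⟩ := exists_step_of_ne (g := fun i => proj P (c i)) hpq
    refine ⟨i, hi.le, ?_⟩
    have := H.dist_eq_of_proj_ne (x := c i) (y := c (i + 1)) hP (by rw [h1]; exact h2.symm)
    rw [h1] at this
    have n1 := dist_nonneg (x := proj P (c 0)) (y := proj P (c (i + 1)))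
    have n2 := dist_nonneg (x := proj P (c (i + 1))) (y := c (i + 1))
    linarith [hstep i hi]
  · obtain ⟨i, hi, h1, h2⟩ := exists_step_of_ne (g := fun i => proj P (c (m - i))) (m := m)
      (by simpa using hpq.symm)
    simp only [Nat.sub_zero] at h1 h2
    refine ⟨m - i, by omega, ?_⟩
    have hs := hstep (m - (i + 1)) (by omega)
    have e : m - (i + 1) + 1 = m - i := by omega
    rw [e] at hs
    have := H.dist_eq_of_proj_ne (x := c (m - (i + 1))) (y := c (m - i)) hP (by rw [h1]; exact h2)
    rw [h1] at this
    have n1 := dist_nonneg (x := proj P (c m)) (y := proj P (c (m - (i + 1))))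
    have n2 := dist_nonneg (x := proj P (c (m - (i + 1)))) (y := c (m - (i + 1)))
    rw [dist_comm (proj P (c m)) (c (m - i))] at this
    rw [dist_comm] at n1 n2
    linarith

end Branching

namespace IsDChain

variable {Y : Type*} {d : Y → Y → ℝ} {r : ℝ} {S : Set Y} {x y z : Y}

lemma refl (hx : x ∈ S) : IsDChain d r S x x :=
  ⟨0, fun _ => x, rfl, rfl, fun _ _ => hx, fun i hi => absurd hi (by omega)⟩

lemma right_mem (h : IsDChain d r S x y) : y ∈ S := by
  obtain ⟨m, c, -, h1, h2, -⟩ := h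
  exact h1 ▸ h2 m le_rfl

lemma snoc (h : IsDChain d r S x y) (hz : z ∈ S) (hyz : d y z < r) : IsDChain d r S x z := by
  obtain ⟨m, c, h0, h1, h2, h3⟩ := h
  refine ⟨m + 1, fun i => if i ≤ m then c i else z, by simpa using h0, by simp, ?_, ?_⟩
  · intro i _
    dsimp only
    split_ifs with hi
    exacts [h2 i hi, hz]
  · intro i hi
    dsimp only
    rw [if_pos (by omega)]
    split_ifs with hi'
    · exact h3 i hi'
    · obtain rfl : i = m := by omega
      rwa [h1]

end IsDChain

section LongPieces

variable {X : Type*} [MetricSpace X] {PX : Set (Set X)} {n : ℕ} {r fr : ℝ} {xhat : X}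
  {proj : Set X → X → X} {cP : Set X → X → Fin (n + 1)}

namespace ColoringSetup

variable {P Q : Set X} {α x y q : X} {γ : ℝ → X} {L : ℝ}

/-- The piece `P` is long on the geodesics from the base point to `x`. -/
def Long (_ : ColoringSetup X PX n r fr xhat proj cP) (P : Set X) (x : X) : Prop :=
  P ∈ PX ∧ proj P x ∉ pieceComp r xhat proj cP P

lemma frpos (H : ColoringSetup X PX n r fr xhat proj cP) : 0 < fr := H.rpos.trans_le H.rlefr

lemma Long.two_mul_lt {H : ColoringSetup X PX n r fr xhat proj cP} (h : H.Long P x) :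
    2 * r < dist (proj P xhat) (proj P x) := by
  by_contra! hd
  have hr := H.rpos
  obtain ⟨γ, hγ, h0, h1, hγP⟩ := H.treeGraded.geodesicSub P h.1 _ (H.projMem P h.1 xhat) _
    (H.projMem P h.1 x)
  set d := dist (proj P xhat) (proj P x) with hdef
  have hd0 : 0 ≤ d := dist_nonneg
  have hmem : ∀ i : ℕ, i ≤ 4 → 0 ≤ i * (d / 4) ∧ i * (d / 4) ≤ d := by
    intro i hi
    have : (i : ℝ) ≤ 4 := by exact_mod_cast hi
    exact ⟨by positivity, by nlinarith⟩
  refine h.2 ⟨4, fun i => γ (i * (d / 4)), by simpa using h0, ?_, ?_, ?_⟩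
  · change γ ((4 : ℕ) * (d / 4)) = _
    rw [← h1]
    congr 1
    push_cast
    ring
  · intro i hi
    have hm := hmem i hi
    refine ⟨hγP _ hm, H.ballZero P h.1 _ (hγP _ hm) ?_⟩
    have := hγ.dist_of_le le_rfl hm.1 hm.2
    rw [h0, dist_comm] at this
    rw [this]
    linarith
  · intro i hi
    have hm := hmem i hi.le
    have hm' := hmem (i + 1) hi
    have := hγ.dist_of_le hm.1 (t := (i + 1 : ℕ) * (d / 4)) (by push_cast; linarith) hm'.2
    rw [this]
    push_cast
    linarith

lemma Long.proj_ne {H : ColoringSetup X PX n r fr xhat proj cP} (h : H.Long P x) :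
    proj P x ≠ proj P xhat := by
  have h1 := h.two_mul_lt
  have h2 := H.rpos
  exact (dist_pos.1 (by linarith)).symm

lemma color_eq_zero_of_not_long (H : ColoringSetup X PX n r fr xhat proj cP) (hP : P ∈ PX)
    (h : ¬ H.Long P x) : cP P (proj P x) = 0 := by
  have h1 : proj P x ∈ pieceComp r xhat proj cP P := by
    by_contra h1
    exact h ⟨hP, h1⟩
  exact (IsDChain.right_mem h1).2

lemma dist_le_of_not_long (H : ColoringSetup X PX n r fr xhat proj cP) (hP : P ∈ PX)
    (h : ¬ H.Long P x) : dist (proj P xhat) (proj P x) ≤ 8 * fr := by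
  have h1 : proj P x ∈ pieceComp r xhat proj cP P := by
    by_contra h1
    exact h ⟨hP, h1⟩
  exact H.zeroBounded P hP _ _ h1

lemma not_long_of_step (H : ColoringSetup X PX n r fr xhat proj cP) (hP : P ∈ PX)
    (h : ¬ H.Long P x) (hxy : dist (proj P x) (proj P y) < r) (hy : cP P (proj P y) = 0) :
    ¬ H.Long P y := by
  have h1 : proj P x ∈ pieceComp r xhat proj cP P := by
    by_contra h1
    exact h ⟨hP, h1⟩
  exact fun h2 => h2.2 (IsDChain.snoc h1 ⟨H.projMem P hP y, hy⟩ hxy)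

lemma long_congr (H : ColoringSetup X PX n r fr xhat proj cP) (h : proj P x = proj P y) :
    H.Long P x ↔ H.Long P y := by
  rw [Long, Long, h]

lemma not_long_base (H : ColoringSetup X PX n r fr xhat proj cP) : ¬ H.Long P xhat :=
  fun h => h.proj_ne rfl

/-- The long pieces of `x` and `y` are the same and have the same exit points. -/
def LongEq (H : ColoringSetup X PX n r fr xhat proj cP) (x y : X) : Prop :=
  ∀ P, H.Long P x ∨ H.Long P y → proj P x = proj P y

lemma LongEq.symm {H : ColoringSetup X PX n r fr xhat proj cP} (h : H.LongEq x y) :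
    H.LongEq y x := fun P hP => (h P hP.symm).symm

lemma LongEq.long_iff {H : ColoringSetup X PX n r fr xhat proj cP} (h : H.LongEq x y) :
    H.Long P x ↔ H.Long P y :=
  ⟨fun hP => (H.long_congr (h P (Or.inl hP))).1 hP,
    fun hP => (H.long_congr (h P (Or.inr hP))).2 hP⟩

/-- `α` is the exit point of the last long piece of `x`, or the base point if there is none. -/
def IsAnchor (H : ColoringSetup X PX n r fr xhat proj cP) (α x : X) : Prop :=
  (∀ P, H.Long P x → dist xhat (proj P x) ≤ dist xhat α) ∧
    ((α = xhat ∧ ∀ P, ¬ H.Long P x) ∨ ∃ Q, H.Long Q x ∧ α = proj Q x)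

lemma IsAnchor.congr {H : ColoringSetup X PX n r fr xhat proj cP} (h : H.IsAnchor α x)
    (hxy : H.LongEq x y) : H.IsAnchor α y := by
  refine ⟨fun P hP => ?_, ?_⟩
  · rw [← hxy P (Or.inr hP)]
    exact h.1 P (hxy.long_iff.2 hP)
  · rcases h.2 with ⟨h1, h2⟩ | ⟨Q, h1, h2⟩
    · exact Or.inl ⟨h1, fun P hP => h2 P (hxy.long_iff.2 hP)⟩
    · exact Or.inr ⟨Q, hxy.long_iff.1 h1, by rw [h2, hxy Q (Or.inl h1)]⟩

lemma dist_base_proj_eq (H : ColoringSetup X PX n r fr xhat proj cP) (hP : P ∈ PX) (x : X) :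
    dist xhat (proj P x) = dist xhat (proj P xhat) + dist (proj P xhat) (proj P x) :=
  H.dist_base_eq hP (H.projMem P hP x)

lemma IsAnchor.dist_eq {H : ColoringSetup X PX n r fr xhat proj cP} (h : H.IsAnchor α x) :
    dist xhat x = dist xhat α + dist α x := by
  rcases h.2 with ⟨rfl, -⟩ | ⟨Q, h1, rfl⟩
  · simp
  · exact H.dist_eq_of_proj_ne_base h1.1 h1.proj_ne

lemma exists_isAnchor (H : ColoringSetup X PX n r fr xhat proj cP) (x : X) :
    ∃ α, H.IsAnchor α x := by
  by_cases hL : ∃ Q, H.Long Q x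
  · have hr := H.rpos
    set S := {t | ∃ Q, H.Long Q x ∧ t = dist xhat (proj Q x)} with hS
    have hne : S.Nonempty := let ⟨Q, hQ⟩ := hL; ⟨_, Q, hQ, rfl⟩
    have hb : BddAbove S := by
      refine ⟨dist xhat x, ?_⟩
      rintro _ ⟨Q, hQ, rfl⟩
      have := H.dist_eq_of_proj_ne_base hQ.1 hQ.proj_ne
      linarith [dist_nonneg (x := proj Q x) (y := x)]
    obtain ⟨_, ⟨Q, hQ, rfl⟩, hlt⟩ := exists_lt_of_lt_csSup hne (sub_lt_self (sSup S) hr)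
    refine ⟨proj Q x, fun P hP => ?_, Or.inr ⟨Q, hQ, rfl⟩⟩
    by_cases hPQ : P = Q
    · rw [hPQ]
    have h1 : dist xhat (proj P x) ≤ sSup S := le_csSup hb ⟨P, hP, rfl⟩
    have h2 := hP.two_mul_lt
    have h3 := hQ.two_mul_lt
    have h4 := H.dist_base_proj_eq hP.1 x
    have h5 := H.dist_base_proj_eq hQ.1 x
    rcases H.before_or_before hP.1 hQ.1 hPQ hP.proj_ne hQ.proj_ne with ⟨h, -⟩ | ⟨h, -⟩
    · linarith
    · linarith
  · push Not at hL
    exact ⟨xhat, fun P hP => absurd hP (hL P), Or.inl ⟨rfl, hL⟩⟩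

lemma IsAnchor.longEq {H : ColoringSetup X PX n r fr xhat proj cP} (h : H.IsAnchor α x) :
    H.LongEq α x := by
  rcases h.2 with ⟨rfl, h1⟩ | ⟨Q, hQ, rfl⟩
  · rintro P (hP | hP)
    · exact absurd hP H.not_long_base
    · exact absurd hP (h1 P)
  · rintro P hP
    have hPX : P ∈ PX := by rcases hP with hP | hP <;> exact hP.1
    by_cases hPQ : P = Q
    · subst hPQ
      exact H.proj_self hPX (H.projMem P hPX x)
    have e := H.proj_eq_of_mem_piece hPX hQ.1 hPQ (H.projMem Q hQ.1 x) (H.projMem Q hQ.1 xhat)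
    rw [e]
    rcases hP with hP | hP
    · exact (H.proj_eq_proj_base hPX hQ.1 hPQ hQ.proj_ne (e ▸ hP.proj_ne)).symm
    · rcases H.before_or_before hPX hQ.1 hPQ hP.proj_ne hQ.proj_ne with ⟨-, h2⟩ | ⟨h2, -⟩
      · exact h2
      · have h3 := h.1 P hP
        have h4 := hP.two_mul_lt
        have h5 := H.dist_base_proj_eq hPX x
        linarith [H.rpos]

lemma IsAnchor.self {H : ColoringSetup X PX n r fr xhat proj cP} (h : H.IsAnchor α x) :
    H.IsAnchor α α := h.congr h.longEq.symm

/-- The position of pieces on a geodesic issued from the base point. -/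
lemma apply_dist_base_eq (H : ColoringSetup X PX n r fr xhat proj cP) (hP : P ∈ PX)
    (hγ : IsGeodesicSegment γ 0 L) (h0 : γ 0 = xhat) {t : ℝ} (ht : t ∈ Icc 0 L) (htP : γ t ∈ P) :
    dist xhat (proj P xhat) ≤ t ∧ γ (dist xhat (proj P xhat)) = proj P xhat := by
  obtain ⟨u, hu, h⟩ := H.exists_eq_proj hP ht.1 (hγ.mono le_rfl ht.2) htP
  have h1 := hγ.dist_of_le le_rfl hu.1 (hu.2.trans ht.2)
  rw [h0] at h h1
  rw [← h, h1, sub_zero]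
  exact ⟨hu.2, rfl⟩

lemma apply_dist_proj_eq (H : ColoringSetup X PX n r fr xhat proj cP) (hP : P ∈ PX)
    (hγ : IsGeodesicSegment γ 0 L) (h0 : γ 0 = xhat) {t : ℝ} (ht : t ∈ Icc 0 L) (htP : γ t ∈ P) :
    t ≤ dist xhat (proj P (γ L)) ∧ γ (dist xhat (proj P (γ L))) = proj P (γ L) ∧
      dist xhat (proj P (γ L)) ≤ L := by
  have hr := (hγ.mono ht.1 le_rfl).reverse
  obtain ⟨u, hu, h⟩ := H.exists_eq_proj hP ht.2 hr (by simpa using htP)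
  have e : t + L - t = L := by ring
  rw [e] at h
  have h1 := hγ.dist_of_le le_rfl (t := t + L - u) (by linarith [hu.2, ht.1]) (by linarith [hu.1])
  rw [h0] at h1
  rw [← h, h1, sub_zero]
  exact ⟨by linarith [hu.2], rfl, by linarith [hu.1]⟩

lemma dist_base_of_segment (hγ : IsGeodesicSegment γ 0 L) (h0 : γ 0 = xhat) {t : ℝ}
    (ht : t ∈ Icc 0 L) : dist xhat (γ t) = t := by
  rw [← h0, hγ.dist_of_le le_rfl ht.1 ht.2, sub_zero]

lemma exists_apply_mem (H : ColoringSetup X PX n r fr xhat proj cP) (hP : P ∈ PX) (hL : 0 ≤ L)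
    (hγ : IsGeodesicSegment γ 0 L) (h0 : γ 0 = xhat) (hne : proj P (γ L) ≠ proj P xhat) :
    ∃ t ∈ Icc 0 L, γ t ∈ P :=
  H.exists_mem_of_proj_ne hP hL hγ (by rw [h0]; exact hne.symm)

lemma IsAnchor.apply_eq {H : ColoringSetup X PX n r fr xhat proj cP} (hL : 0 ≤ L)
    (hγ : IsGeodesicSegment γ 0 L) (h0 : γ 0 = xhat) (h : H.IsAnchor α (γ L)) :
    γ (dist xhat α) = α := by
  rcases h.2 with ⟨rfl, -⟩ | ⟨Q, hQ, rfl⟩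
  · rwa [dist_self]
  · obtain ⟨t, ht, htQ⟩ := H.exists_apply_mem hQ.1 hL hγ h0 hQ.proj_ne
    exact (H.apply_dist_proj_eq hQ.1 hγ h0 ht htQ).2.1

/-- The set of parameters outside the reduced long pieces, on a geodesic from the base point
to `x`. -/
def reducedSet (H : ColoringSetup X PX n r fr xhat proj cP) (x : X) : Set ℝ :=
  {t | t ∈ Icc 0 (dist xhat x) ∧
    ∀ P, H.Long P x → t ∉ Ioo (dist xhat (proj P xhat) + r / 2) (dist xhat (proj P x))}

lemma betaSet_eq (H : ColoringSetup X PX n r fr xhat proj cP) (hL : 0 ≤ L)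
    (hγ : IsGeodesicSegment γ 0 L) (h0 : γ 0 = xhat) :
    betaSet PX r xhat proj cP γ L = H.reducedSet (γ L) := by
  have hLd : dist xhat (γ L) = L := dist_base_of_segment hγ h0 ⟨hL, le_rfl⟩
  have hlong : ∀ P, IsLongPiece PX r xhat proj cP γ L P ↔ H.Long P (γ L) := fun P =>
    ⟨fun h => ⟨h.1, h.2.2⟩, fun h => ⟨h.1, H.exists_apply_mem h.1 hL hγ h0 h.proj_ne, h.2⟩⟩
  have hse : ∀ P, H.Long P (γ L) → pieceStart γ L P = dist xhat (proj P xhat) ∧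
      pieceEnd γ L P = dist xhat (proj P (γ L)) := by
    intro P hP
    obtain ⟨t, ht, htP⟩ := H.exists_apply_mem hP.1 hL hγ h0 hP.proj_ne
    have h1 := H.apply_dist_base_eq hP.1 hγ h0 ht htP
    have h2 := H.apply_dist_proj_eq hP.1 hγ h0 ht htP
    constructor
    · refine IsLeast.csInf_eq ⟨⟨⟨dist_nonneg, h1.1.trans ht.2⟩, ?_⟩, fun u hu =>
        (H.apply_dist_base_eq hP.1 hγ h0 hu.1 hu.2).1⟩
      rw [h1.2]
      exact H.projMem P hP.1 xhat
    · refine IsGreatest.csSup_eq ⟨⟨⟨dist_nonneg, h2.2.2⟩, ?_⟩, fun u hu =>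
        (H.apply_dist_proj_eq hP.1 hγ h0 hu.1 hu.2).1⟩
      rw [h2.2.1]
      exact H.projMem P hP.1 _
  ext t
  simp only [betaSet, reducedSet, mem_sdiff, mem_iUnion, mem_ofPred_eq, exists_prop, not_exists,
    not_and, hLd, hlong]
  refine and_congr_right fun _ => forall_congr' fun P => imp_congr_right fun hP => ?_
  rw [(hse P hP).1, (hse P hP).2]

end ColoringSetup

end LongPieces

/-- The interval `[u, v]` is a connected component of `B`, isolated from the other ones. -/
def IsIsolatedInterval (B : Set ℝ) (u v : ℝ) : Prop :=
  u ≤ v ∧ Icc u v ⊆ B ∧ (∀ ε > 0, ∃ t ∈ Ioo v (v + ε), t ∉ B) ∧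
    ∀ ε > 0, ∃ t ∈ Ioo (u - ε) u, t ∉ B

namespace IsIsolatedInterval

variable {B B' : Set ℝ} {u v u' v' w : ℝ}

lemma right_le (h : IsIsolatedInterval B u v) (h' : IsIsolatedInterval B u' v')
    (h1 : u' ≤ v) : v' ≤ v := by
  by_contra! hlt
  obtain ⟨t, ht, htB⟩ := h.2.2.1 (v' - v) (by linarith)
  exact htB (h'.2.1 ⟨by linarith [ht.1], by linarith [ht.2]⟩)

lemma le_left (h : IsIsolatedInterval B u v) (h' : IsIsolatedInterval B u' v')
    (h1 : u ≤ v') : u ≤ u' := by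
  by_contra! hlt
  obtain ⟨t, ht, htB⟩ := h.2.2.2 (u - u') (by linarith)
  exact htB (h'.2.1 ⟨by linarith [ht.1], by linarith [ht.2]⟩)

lemma unique (h : IsIsolatedInterval B u v) (h' : IsIsolatedInterval B u' v')
    (h1 : u ≤ v') (h2 : u' ≤ v) : u = u' ∧ v = v' :=
  ⟨le_antisymm (h.le_left h' h1) (h'.le_left h h2),
    le_antisymm (h'.right_le h h1) (h.right_le h' h2)⟩

lemma congr (h : IsIsolatedInterval B u v) (hB : ∀ t < w, t ∈ B ↔ t ∈ B') (hv : v < w) :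
    IsIsolatedInterval B' u v := by
  refine ⟨h.1, fun t ht => (hB t (ht.2.trans_lt hv)).1 (h.2.1 ht), fun ε hε => ?_, fun ε hε => ?_⟩
  · obtain ⟨t, ht, htB⟩ := h.2.2.1 (min ε (w - v)) (lt_min hε (by linarith))
    have h1 := min_le_left ε (w - v)
    have h2 := min_le_right ε (w - v)
    exact ⟨t, ⟨ht.1, by linarith [ht.2]⟩, fun h => htB ((hB t (by linarith [ht.2])).2 h)⟩
  · obtain ⟨t, ht, htB⟩ := h.2.2.2 ε hε
    exact ⟨t, ht, fun h' => htB ((hB t (by linarith [ht.2, h.1])).2 h')⟩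

end IsIsolatedInterval

lemma isIsolatedInterval_of_eq_iUnion {B : Set ℝ} {k : ℕ} {a b : Fin k → ℝ}
    (hab : ∀ i, a i ≤ b i) (hB : B = ⋃ i, Icc (a i) (b i))
    (hd : ∀ i j, i ≠ j → b i < a j ∨ b j < a i) (i : Fin k) :
    IsIsolatedInterval B (a i) (b i) := by
  have hC : IsClosed (⋃ j ∈ {j | j ≠ i}, Icc (a j) (b j)) :=
    (Set.toFinite _).isClosed_biUnion fun j _ => isClosed_Icc
  have hmem : ∀ t ∈ Icc (a i) (b i), t ∉ ⋃ j ∈ {j | j ≠ i}, Icc (a j) (b j) := by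
    intro t ht h
    simp only [mem_iUnion, mem_ofPred_eq, exists_prop] at h
    obtain ⟨j, hj, h⟩ := h
    rcases hd i j hj.symm with h1 | h1
    · linarith [ht.2, h.1]
    · linarith [ht.1, h.2]
  have hcase : ∀ t ∉ ⋃ j ∈ {j | j ≠ i}, Icc (a j) (b j), t ∉ Icc (a i) (b i) → t ∉ B := by
    intro t h1 h2 h
    rw [hB] at h
    obtain ⟨j, hj⟩ := mem_iUnion.1 h
    by_cases hji : j = i
    · exact h2 (hji ▸ hj)
    · exact h1 (mem_biUnion hji hj)
  refine ⟨hab i, hB ▸ subset_iUnion (fun i => Icc (a i) (b i)) i, fun ε hε => ?_, fun ε hε => ?_⟩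
  · obtain ⟨δ, hδ, h⟩ := Metric.isOpen_iff.1 hC.isOpen_compl _ (hmem _ ⟨hab i, le_rfl⟩)
    have hm := lt_min hε hδ
    have h1 := min_le_left ε δ
    have h2 := min_le_right ε δ
    refine ⟨b i + min ε δ / 2, ⟨by linarith, by linarith⟩, hcase _ (h ?_) fun h => ?_⟩
    · rw [mem_ball, Real.dist_eq, add_sub_cancel_left, abs_of_pos (by linarith)]
      linarith
    · linarith [h.2]
  · obtain ⟨δ, hδ, h⟩ := Metric.isOpen_iff.1 hC.isOpen_compl _ (hmem _ ⟨le_rfl, hab i⟩)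
    have hm := lt_min hε hδ
    have h1 := min_le_left ε δ
    have h2 := min_le_right ε δ
    refine ⟨a i - min ε δ / 2, ⟨by linarith, by linarith⟩, hcase _ (h ?_) fun h => ?_⟩
    · rw [mem_ball, Real.dist_eq, sub_sub_cancel_left, abs_neg, abs_of_pos (by linarith)]
      linarith
    · linarith [h.1]

lemma exists_finset_isIsolatedInterval {B : Set ℝ} {k : ℕ} {a b : Fin k → ℝ}
    (hab : ∀ i, a i ≤ b i) (hB : B = ⋃ i, Icc (a i) (b i))
    (hd : ∀ i j, i ≠ j → b i < a j ∨ b j < a i) :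
    ∃ T : Finset (ℝ × ℝ), (∀ p, p ∈ T ↔ IsIsolatedInterval B p.1 p.2) ∧
      ∀ g : ℝ → ℝ → ℕ, ∑ i, g (a i) (b i) = ∑ p ∈ T, g p.1 p.2 := by
  classical
  have hi := isIsolatedInterval_of_eq_iUnion hab hB hd
  refine ⟨Finset.univ.image fun i => (a i, b i), fun p => ?_, fun g => ?_⟩
  · simp only [Finset.mem_image, Finset.mem_univ, true_and]
    constructor
    · rintro ⟨i, rfl⟩
      exact hi i
    · intro hp
      have h : p.1 ∈ B := hp.2.1 ⟨le_rfl, hp.1⟩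
      rw [hB] at h
      obtain ⟨i, h⟩ := mem_iUnion.1 h
      have := (hi i).unique hp (h.1.trans hp.1) h.2
      exact ⟨i, Prod.ext this.1 this.2⟩
  · rw [Finset.sum_image]
    intro i _ j _ hij
    by_contra hne
    simp only [Prod.mk.injEq] at hij
    have h1 := hab i
    have h2 := hab j
    rcases hd i j hne with h | h <;> linarith

/-- Two finite families of isolated intervals of sets agreeing before `w` differ only by the
last intervals. -/
lemma sum_isolatedInterval_eq {B B' : Set ℝ} {T T' : Finset (ℝ × ℝ)}
    (hT : ∀ p, p ∈ T ↔ IsIsolatedInterval B p.1 p.2)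
    (hT' : ∀ p, p ∈ T' ↔ IsIsolatedInterval B' p.1 p.2) {w s L : ℝ}
    (hBB : ∀ t < w, t ∈ B ↔ t ∈ B') (hL : w ≤ L) (hB : IsIsolatedInterval B s L)
    (hlast : ∀ t ∈ B, w ≤ t → s ≤ t ∧ t ≤ L) (g : ℝ × ℝ → ℕ) :
    ∑ p ∈ T, g p = g (s, L) + ∑ p ∈ T' with p.2 < w, g p := by
  classical
  have : T = insert (s, L) {p ∈ T' | p.2 < w} := by
    ext p
    simp only [Finset.mem_insert, Finset.mem_filter, hT, hT']
    constructor
    · intro hp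
      by_cases hw : p.2 < w
      · exact Or.inr ⟨hp.congr hBB hw, hw⟩
      · left
        have h1 := hlast p.2 (hp.2.1 ⟨hp.1, le_rfl⟩) (not_lt.1 hw)
        have := hp.unique hB (hp.1.trans h1.2) h1.1
        exact Prod.ext this.1 this.2
    · rintro (rfl | ⟨h1, h2⟩)
      · exact hB
      · exact h1.congr (fun t ht => (hBB t ht).symm) h2
  rw [this, Finset.sum_insert]
  simp [hL]

lemma floorLen_self {X : Type*} {PX : Set (Set X)} (hcov : ∀ x : X, ∃ P ∈ PX, x ∈ P)
    (γ : ℝ → X) (s : ℝ) :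
    floorLen PX γ s s = 0 := by
  have : {t | t ∈ Icc s s ∧ ∃ P ∈ PX, γ '' Icc t s ⊆ P} = {s} := by
    ext t
    constructor
    · rintro ⟨h, -⟩
      exact le_antisymm h.2 h.1
    · rintro rfl
      obtain ⟨P, hP, h⟩ := hcov (γ t)
      exact ⟨⟨le_rfl, le_rfl⟩, P, hP, by simpa using h⟩
  rw [floorLen, this, csInf_singleton, sub_self]

section ColorFormulas

variable {X : Type*} [MetricSpace X] {PX : Set (Set X)} {n : ℕ} {r fr : ℝ} {xhat : X}
  {proj : Set X → X → X} {cP : Set X → X → Fin (n + 1)}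

namespace ColoringSetup

variable {P Q : Set X} {α x y q : X} {γ : ℝ → X} {L e : ℝ} {cX : X → Fin (n + 1)}

/-- The map `cX` is the coloring `c*_X`. -/
def IsColoring (_ : ColoringSetup X PX n r fr xhat proj cP) (cX : X → Fin (n + 1)) : Prop :=
  ∀ (γ : ℝ → X) (L : ℝ), 0 ≤ L → IsGeodesicSegment γ 0 L → γ 0 = xhat →
    ColorValue PX r fr xhat proj cP γ L (cX (γ L))

lemma exists_color_formula (H : ColoringSetup X PX n r fr xhat proj cP) (hcX : H.IsColoring cX)
    (hL : 0 ≤ L) (hγ : IsGeodesicSegment γ 0 L) (h0 : γ 0 = xhat) :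
    ∃ (Ps : Finset (Set X)) (T : Finset (ℝ × ℝ)),
      (∀ P, P ∈ Ps ↔ P ∈ PX ∧ cP P (proj P (γ L)) ≠ 0) ∧
      (∀ p, p ∈ T ↔ IsIsolatedInterval (H.reducedSet (γ L)) p.1 p.2) ∧
      (cX (γ L) : ℕ) ≡ ∑ P ∈ Ps, (cP P (proj P (γ L)) : ℕ) +
        ∑ p ∈ T, ⌊floorLen PX γ p.1 p.2 / (99 * fr)⌋₊ [MOD n + 1] := by
  obtain ⟨Ps, k, a, b, hPs, hab, hB, hd, hv⟩ := hcX γ L hL hγ h0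
  rw [H.betaSet_eq hL hγ h0] at hB
  obtain ⟨T, hT, hg⟩ := exists_finset_isIsolatedInterval hab hB hd
  refine ⟨Ps, T, fun P => ?_, hT, ?_⟩
  · rw [← Finset.mem_coe, hPs]
    rfl
  · rw [hv, hg fun a b => ⌊floorLen PX γ a b / (99 * fr)⌋₊]
    exact Nat.mod_modEq _ _

lemma IsAnchor.isIsolatedInterval {H : ColoringSetup X PX n r fr xhat proj cP}
    (h : H.IsAnchor α x) : IsIsolatedInterval (H.reducedSet x) (dist xhat α) (dist xhat x) := by
  have hd := h.dist_eq
  have hr := H.rpos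
  refine ⟨by linarith [dist_nonneg (x := α) (y := x)], fun t ht => ⟨⟨dist_nonneg.trans ht.1, ht.2⟩,
    fun P hP ht' => ?_⟩, fun ε hε => ?_, fun ε hε => ?_⟩
  · linarith [h.1 P hP, ht.1, ht'.2]
  · exact ⟨dist xhat x + ε / 2, ⟨by linarith, by linarith⟩, fun h => by linarith [h.1.2]⟩
  · rcases h.2 with ⟨rfl, -⟩ | ⟨Q, hQ, rfl⟩
    · refine ⟨-(ε / 2), ?_, fun h => by linarith [h.1.1]⟩
      rw [dist_self]
      exact ⟨by linarith, by linarith⟩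
    · have h1 := hQ.two_mul_lt
      have h2 := H.dist_base_proj_eq hQ.1 x
      have h3 := min_le_left ε r
      have h4 := min_le_right ε r
      have h5 := lt_min hε hr
      exact ⟨dist xhat (proj Q x) - min ε r / 2, ⟨by linarith, by linarith⟩,
        fun h => h.2 Q hQ ⟨by linarith, by linarith⟩⟩

/-- The properties of the length `e` of the last unreduced part `⌊β⌋` of a geodesic from the base
point to `x`, where `α` is the anchor of `x`. -/
structure IsResidue (_ : ColoringSetup X PX n r fr xhat proj cP) (α x : X) (e : ℝ) : Prop where
  nonneg : 0 ≤ e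
  le_sub : e ≤ dist xhat x - dist xhat α
  sub_le : dist xhat x - dist xhat α - 8 * fr ≤ e
  base_le : ∀ Q ∈ PX, proj Q x ≠ proj Q xhat → dist xhat α ≤ dist xhat (proj Q xhat) →
    dist xhat (proj Q xhat) - dist xhat α ≤ e
  le_base : ∀ Q ∈ PX, x ∈ Q → dist xhat α ≤ dist xhat (proj Q xhat) →
    e ≤ dist xhat (proj Q xhat) - dist xhat α

lemma IsAnchor.isResidue {H : ColoringSetup X PX n r fr xhat proj cP} (hL : 0 ≤ L)
    (hγ : IsGeodesicSegment γ 0 L) (h0 : γ 0 = xhat) (h : H.IsAnchor α (γ L)) :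
    H.IsResidue α (γ L) (floorLen PX γ (dist xhat α) L) := by
  have hLd : dist xhat (γ L) = L := dist_base_of_segment hγ h0 ⟨hL, le_rfl⟩
  have hd := h.dist_eq
  have hF := H.frpos
  set s := dist xhat α with hs
  have hs0 : 0 ≤ s := dist_nonneg
  have hsL : s ≤ L := by linarith [dist_nonneg (x := α) (y := γ L)]
  set S := {t | t ∈ Icc s L ∧ ∃ P ∈ PX, γ '' Icc t L ⊆ P} with hS
  have hbdd : BddBelow S := ⟨s, fun t ht => ht.1.1⟩
  have hLS : L ∈ S := by
    obtain ⟨P, hP, h⟩ := H.treeGraded.covers (γ L)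
    exact ⟨⟨hsL, le_rfl⟩, P, hP, by simpa using h⟩
  have hge : ∀ m, (∀ t ∈ S, m ≤ t) → m - s ≤ floorLen PX γ s L := fun m hm =>
    sub_le_sub_right (le_csInf ⟨L, hLS⟩ hm) s
  have hle : ∀ t ∈ S, floorLen PX γ s L ≤ t - s := fun t ht => sub_le_sub_right (csInf_le hbdd ht) s
  have hpar : ∀ t ∈ S, t ∈ Icc 0 L := fun t ht => ⟨hs0.trans ht.1.1, ht.1.2⟩
  refine ⟨?_, ?_, ?_, fun Q hQ hne hsQ => hge _ fun t ht => ?_, fun Q hQ hxQ hsQ => hle _ ?_⟩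
  · have := hge s fun t ht => ht.1.1
    linarith
  · rw [hLd]
    exact hle L hLS
  · rw [hLd]
    have := hge (L - 8 * fr) fun t ht => by
      obtain ⟨P, hP, hsub⟩ := ht.2
      have hxP : γ L ∈ P := hsub ⟨L, ⟨ht.1.2, le_rfl⟩, rfl⟩
      have htP : γ t ∈ P := hsub ⟨t, ⟨le_rfl, ht.1.2⟩, rfl⟩
      have e := H.proj_self hP hxP
      by_cases hl : H.Long P (γ L)
      · have := h.1 P hl
        rw [e, hLd] at this
        linarith [ht.1.1]
      · have h1 := H.dist_le_of_not_long hP hl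
        have h2 := H.dist_base_eq hP hxP
        have h3 := (H.apply_dist_base_eq hP hγ h0 (hpar t ht) htP).1
        rw [e] at h1
        linarith
    linarith
  · obtain ⟨P, hP, hsub⟩ := ht.2
    obtain ⟨u, hu, huQ⟩ := H.exists_apply_mem hQ hL hγ h0 hne
    have h1 := H.apply_dist_base_eq hQ hγ h0 hu huQ
    have h2 := H.apply_dist_proj_eq hQ hγ h0 hu huQ
    have htP : γ t ∈ P := hsub ⟨t, ⟨le_rfl, ht.1.2⟩, rfl⟩
    by_contra! hlt
    by_cases hPQ : P = Q
    · subst hPQ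
      linarith [(H.apply_dist_base_eq hQ hγ h0 (hpar t ht) htP).1]
    · refine hne (H.treeGraded.t1 P hP Q hQ hPQ ⟨?_, H.projMem Q hQ _⟩ ⟨?_, H.projMem Q hQ _⟩)
      · rw [← h2.2.1]
        exact hsub ⟨_, ⟨by linarith, h2.2.2⟩, rfl⟩
      · rw [← h1.2]
        exact hsub ⟨_, ⟨by linarith, by linarith⟩, rfl⟩
  · have h1 := H.apply_dist_base_eq hQ hγ h0 ⟨hL, le_rfl⟩ hxQ
    refine ⟨⟨hsQ, h1.1⟩, Q, hQ, ?_⟩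
    rintro _ ⟨t, ht, rfl⟩
    refine H.mem_of_dist_add_eq hQ (H.projMem Q hQ xhat) hxQ ?_
    have d0 : 0 ≤ dist xhat (proj Q xhat) := dist_nonneg
    have e1 := hγ.dist_of_le d0 ht.1 ht.2
    have e2 := hγ.dist_of_le (d0.trans ht.1) ht.2 le_rfl
    have e3 := hγ.dist_of_le d0 (ht.1.trans ht.2) le_rfl
    rw [h1.2] at e1 e3
    linarith

/-- The color of `x` in terms of the color of its anchor. -/
lemma IsAnchor.exists_color_modEq {H : ColoringSetup X PX n r fr xhat proj cP}
    (hcX : H.IsColoring cX) (h : H.IsAnchor α x) :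
    ∃ e, H.IsResidue α x e ∧ (cX x : ℕ) ≡ cX α + ⌊e / (99 * fr)⌋₊ [MOD n + 1] := by
  obtain ⟨γ, hγ, h0, h1⟩ := H.geodesic xhat x
  set L := dist xhat x with hL
  have hL0 : 0 ≤ L := dist_nonneg
  have hα : γ (dist xhat α) = α := IsAnchor.apply_eq hL0 hγ h0 (h1.symm ▸ h)
  have hres := IsAnchor.isResidue hL0 hγ h0 (h1.symm ▸ h)
  rw [h1] at hres
  refine ⟨_, hres, ?_⟩
  have hd := h.dist_eq
  have hsL : dist xhat α ≤ L := by linarith [dist_nonneg (x := α) (y := x)]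
  obtain ⟨Ps, T, hPs, hT, hc⟩ := H.exists_color_formula hcX hL0 hγ h0
  obtain ⟨Ps', T', hPs', hT', hc'⟩ :=
    H.exists_color_formula hcX dist_nonneg (hγ.mono le_rfl hsL) h0
  rw [h1] at hPs hT hc
  rw [hα] at hPs' hT' hc'
  have hloc : ∀ t < dist xhat α, t ∈ H.reducedSet x ↔ t ∈ H.reducedSet α := by
    intro t ht
    refine and_congr ⟨fun h => ⟨h.1, ht.le⟩, fun h => ⟨h.1, ht.le.trans hsL⟩⟩
      (forall_congr' fun P => ?_)
    rw [h.longEq.long_iff]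
    refine imp_congr_right fun hP => ?_
    rw [h.longEq P (Or.inr hP)]
  have eP : Ps = Ps' := by
    ext P
    rw [hPs, hPs']
    refine and_congr_right fun hP => ?_
    by_cases hl : H.Long P x
    · rw [h.longEq P (Or.inr hl)]
    · have hl' : ¬ H.Long P α := fun h' => hl (h.longEq.long_iff.1 h')
      simp [H.color_eq_zero_of_not_long hP hl, H.color_eq_zero_of_not_long hP hl']
  subst eP
  have eS : ∑ P ∈ Ps, (cP P (proj P α) : ℕ) = ∑ P ∈ Ps, (cP P (proj P x) : ℕ) := by
    refine Finset.sum_congr rfl fun P hP => ?_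
    have h1 := (hPs P).1 hP
    rw [h.longEq P]
    by_contra! hl
    exact h1.2 (H.color_eq_zero_of_not_long h1.1 hl.2)
  rw [sum_isolatedInterval_eq hT hT' hloc hsL h.isIsolatedInterval
    (fun t ht h2 => ⟨h2, ht.1.2⟩) fun p => ⌊floorLen PX γ p.1 p.2 / (99 * fr)⌋₊] at hc
  rw [sum_isolatedInterval_eq hT' hT' (fun _ _ => Iff.rfl) le_rfl h.self.isIsolatedInterval
    (fun t ht h2 => ⟨h2, ht.1.2⟩) fun p => ⌊floorLen PX γ p.1 p.2 / (99 * fr)⌋₊, eS,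
    floorLen_self H.treeGraded.covers, zero_div, Nat.floor_zero, zero_add] at hc'
  refine hc.trans ?_
  rw [add_comm (⌊_⌋₊), ← add_assoc]
  exact (hc'.symm).add_right _

/-- A point of a piece close to the base point of this piece has the same long pieces as this
base point. -/
lemma longEq_base (H : ColoringSetup X PX n r fr xhat proj cP) (hQ : Q ∈ PX) (hy : y ∈ Q)
    (hd : dist (proj Q xhat) y ≤ 2 * r) : H.LongEq y (proj Q xhat) := by
  have hb := H.projMem Q hQ xhat
  intro P hP
  have hPX : P ∈ PX := by rcases hP with hP | hP <;> exact hP.1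
  by_cases hPQ : P = Q
  · subst hPQ
    rcases hP with hP | hP
    · have := hP.two_mul_lt
      rw [H.proj_self hPX hy] at this
      linarith
    · exact absurd (H.proj_self hPX hb) hP.proj_ne
  · exact H.proj_eq_of_mem_piece hPX hQ hPQ hy hb

/-- The color of a point `q` of a long piece in terms of the color of a point `y` at the beginning
of the reduced part of this piece. -/
lemma exists_color_modEq_of_mem (H : ColoringSetup X PX n r fr xhat proj cP)
    (hcX : H.IsColoring cX) (hlong : H.Long Q q) (hq : q ∈ Q) :
    ∃ y ∈ Q, dist (proj Q xhat) y = r / 2 ∧ (cX q : ℕ) ≡ cX y + cP Q q [MOD n + 1] := by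
  classical
  obtain ⟨γ, hγ, h0, h1⟩ := H.geodesic xhat q
  set L := dist xhat q with hL
  have hL0 : 0 ≤ L := dist_nonneg
  have hQ := hlong.1
  have hr := H.rpos
  have hb := H.apply_dist_base_eq hQ hγ h0 ⟨hL0, le_rfl⟩ (h1.symm ▸ hq)
  have hgt := hlong.two_mul_lt
  have hself := H.proj_self hQ hq
  have hdq := H.dist_base_eq hQ hq
  have hb0 : 0 ≤ dist xhat (proj Q xhat) := dist_nonneg
  rw [hself] at hgt
  set s := dist xhat (proj Q xhat) + r / 2 with hs
  have hsL : s < L := by linarith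
  have hs0 : 0 ≤ s := by positivity
  have hby := hγ.dist_of_le hb0 (t := s) (by linarith) hsL.le
  have hyq := hγ.dist_of_le hs0 hsL.le le_rfl
  rw [hb.2] at hby
  rw [h1] at hyq
  have hy : γ s ∈ Q := H.mem_of_dist_add_eq hQ (H.projMem Q hQ xhat) hq (by linarith)
  have hdy : dist xhat (γ s) = s := dist_base_of_segment hγ h0 ⟨hs0, hsL.le⟩
  refine ⟨γ s, hy, by linarith, ?_⟩
  have hproj : ∀ P ∈ PX, P ≠ Q → proj P q = proj P (γ s) := fun P hP hPQ =>
    H.proj_eq_of_mem_piece hP hQ hPQ hq hy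
  have hQy : ¬ H.Long Q (γ s) := fun h => by
    have := h.two_mul_lt
    rw [H.proj_self hQ hy] at this
    linarith
  have hlongP : ∀ P, P ≠ Q → (H.Long P q ↔ H.Long P (γ s)) := fun P hPQ =>
    ⟨fun h => (H.long_congr (hproj P h.1 hPQ)).1 h, fun h => (H.long_congr (hproj P h.1 hPQ)).2 h⟩
  obtain ⟨Ps, T, hPs, hT, hc⟩ := H.exists_color_formula hcX hL0 hγ h0
  obtain ⟨Ps', T', hPs', hT', hc'⟩ :=
    H.exists_color_formula hcX hs0 (hγ.mono le_rfl hsL.le) h0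
  rw [h1] at hPs hT hc
  have hmemL : L ∈ H.reducedSet q := by
    refine ⟨⟨hL0, le_rfl⟩, fun P hP h => ?_⟩
    have h2 := H.dist_eq_of_proj_ne_base hP.1 hP.proj_ne
    linarith [h.2, dist_nonneg (x := proj P q) (y := q)]
  have hgap : ∀ t ∈ Ioo s L, t ∉ H.reducedSet q := by
    intro t ht h
    refine h.2 Q hlong ?_
    rwa [hself]
  have hiso : IsIsolatedInterval (H.reducedSet q) L L := by
    refine ⟨le_rfl, by simpa using hmemL, fun ε hε => ?_, fun ε hε => ?_⟩
    · exact ⟨L + ε / 2, ⟨by linarith, by linarith⟩, fun h => by linarith [h.1.2]⟩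
    · have h3 := min_le_left ε (L - s)
      have h4 := min_le_right ε (L - s)
      have h5 := lt_min hε (sub_pos.2 hsL)
      exact ⟨L - min ε (L - s) / 2, ⟨by linarith, by linarith⟩,
        hgap _ ⟨by linarith, by linarith⟩⟩
  have hloc : ∀ t < L, t ∈ H.reducedSet q ↔ t ∈ H.reducedSet (γ s) := by
    intro t ht
    constructor
    · intro h
      have hts : t ≤ s := by
        by_contra! hlt
        exact hgap t ⟨hlt, ht⟩ h
      refine ⟨⟨h.1.1, by rwa [hdy]⟩, fun P hP => ?_⟩
      have hPQ : P ≠ Q := by rintro rfl; exact hQy hP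
      rw [← hproj P hP.1 hPQ]
      exact h.2 P ((hlongP P hPQ).2 hP)
    · intro h
      have hts := h.1.2
      rw [hdy] at hts
      refine ⟨⟨h.1.1, ht.le⟩, fun P hP => ?_⟩
      by_cases hPQ : P = Q
      · subst hPQ
        exact fun h' => by linarith [h'.1]
      · rw [hproj P hP.1 hPQ]
        exact h.2 P ((hlongP P hPQ).1 hP)
  rw [sum_isolatedInterval_eq hT hT' hloc le_rfl hiso (fun t ht h2 => ⟨h2, ht.1.2⟩)
    fun p => ⌊floorLen PX γ p.1 p.2 / (99 * fr)⌋₊, floorLen_self H.treeGraded.covers, zero_div,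
    Nat.floor_zero, zero_add, Finset.filter_true_of_mem] at hc
  swap
  · intro p hp
    have h2 := (hT' p).1 hp
    have h3 := (h2.2.1 ⟨h2.1, le_rfl⟩).1.2
    rw [hdy] at h3
    linarith
  have hQPs : Q ∉ Ps' := fun h => by
    refine ((hPs' Q).1 h).2 (H.ballZero Q hQ _ (H.projMem Q hQ _) ?_)
    rw [H.proj_self hQ hy, dist_comm]
    linarith
  have hPne : ∀ P ∈ Ps', P ≠ Q := by
    rintro P hP rfl
    exact hQPs hP
  have eS : ∑ P ∈ Ps, (cP P (proj P q) : ℕ) =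
      cP Q q + ∑ P ∈ Ps', (cP P (proj P (γ s)) : ℕ) := by
    have h2 : Ps ⊆ insert Q Ps' := by
      intro P hP
      have h3 := (hPs P).1 hP
      by_cases hPQ : P = Q
      · exact hPQ ▸ Finset.mem_insert_self _ _
      · refine Finset.mem_insert_of_mem ((hPs' P).2 ⟨h3.1, ?_⟩)
        rw [← hproj P h3.1 hPQ]
        exact h3.2
    rw [Finset.sum_subset h2, Finset.sum_insert hQPs, hself]
    · congr 1
      exact Finset.sum_congr rfl fun P hP => by rw [hproj P ((hPs' P).1 hP).1 (hPne P hP)]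
    · intro P hP hP'
      have hPX : P ∈ PX := by
        rcases Finset.mem_insert.1 hP with rfl | h
        exacts [hQ, ((hPs' P).1 h).1]
      by_contra h3
      exact hP' ((hPs P).2 ⟨hPX, fun h4 => h3 (by rw [h4]; rfl)⟩)
  rw [eS] at hc
  refine hc.trans ?_
  rw [add_assoc, add_comm (cP Q q : ℕ)]
  exact hc'.symm.add_right _

/-- The color of a point `q` of a long piece `Q` in terms of the color of the anchor of the base
point of `Q`. -/
lemma color_modEq_of_mem (H : ColoringSetup X PX n r fr xhat proj cP)
    (hcX : H.IsColoring cX) (hlong : H.Long Q q) (hq : q ∈ Q) (hα : H.IsAnchor α (proj Q xhat)) :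
    (cX q : ℕ) ≡ cX α +
      ⌊(dist xhat (proj Q xhat) - dist xhat α) / (99 * fr)⌋₊ + cP Q q [MOD n + 1] := by
  have hr := H.rpos
  obtain ⟨y, hy, hd, hc⟩ := H.exists_color_modEq_of_mem hcX hlong hq
  have hαy := hα.congr (H.longEq_base hlong.1 hy (by linarith)).symm
  obtain ⟨e, he, hce⟩ := hαy.exists_color_modEq hcX
  have hle : dist xhat α ≤ dist xhat (proj Q xhat) := by
    have := hα.dist_eq
    linarith [dist_nonneg (x := α) (y := proj Q xhat)]
  have h1 := he.le_base Q hlong.1 hy hle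
  have h2 := he.base_le Q hlong.1 (by
    rw [H.proj_self hlong.1 hy]
    exact (dist_pos.1 (by linarith)).symm) hle
  rw [← le_antisymm h1 h2]
  exact hc.trans (hce.add_right _)

end ColoringSetup

end ColorFormulas

section Steps

variable {X : Type*} [MetricSpace X] {PX : Set (Set X)} {n : ℕ} {r fr : ℝ} {xhat : X}
  {proj : Set X → X → X} {cP : Set X → X → Fin (n + 1)}

lemma eq_of_add_modEq_of_le {n c k k' : ℕ} (hn : 0 < n) (h : c + k ≡ c + k' [MOD n + 1])
    (h1 : k ≤ k' + 1) (h2 : k' ≤ k + 1) : k = k' := by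
  have h3 : k ≡ k' [MOD n + 1] := Nat.ModEq.add_left_cancel' c h
  have h4 := (Nat.modEq_iff_dvd.1 h3)
  obtain ⟨z, hz⟩ := h4
  have h5 : z = 0 := by
    push_cast at hz
    by_contra hne
    rcases lt_or_gt_of_ne hne with h | h
    · have : z ≤ -1 := by omega
      nlinarith
    · have : 1 ≤ z := by omega
      nlinarith
  subst h5
  omega

lemma floor_div_le_add_one {e e' M : ℝ} (hM : 0 < M) (he' : 0 ≤ e') (h : e ≤ e' + M) :
    ⌊e / M⌋₊ ≤ ⌊e' / M⌋₊ + 1 := by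
  rw [← Nat.floor_add_one (by positivity)]
  refine Nat.floor_le_floor ?_
  rw [div_le_iff₀ hM, add_mul, div_mul_cancel₀ _ hM.ne']
  linarith

namespace ColoringSetup

variable {P Q : Set X} {a α x y q q₁ : X} {K : ℕ} {cX : X → Fin (n + 1)}

/-- A short step moving the projection to a long piece `Q` of `y` takes place close to `Q`, and
does not move the exit points of the other long pieces, which all come before `Q`. -/
lemma Long.step {H : ColoringSetup X PX n r fr xhat proj cP} (hQ : H.Long Q y)
    (hxy : dist x y < r) (hne : proj Q x ≠ proj Q y) :
    dist x (proj Q x) + dist (proj Q x) (proj Q y) + dist (proj Q y) y < r ∧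
      H.IsAnchor (proj Q y) y ∧
      (∀ P ≠ Q, H.Long P x ∨ H.Long P y ∨ H.Long P (proj Q xhat) →
        proj P x = proj P (proj Q xhat) ∧ proj P y = proj P (proj Q xhat)) ∧
      proj Q x ≠ proj Q xhat := by
  have hr := H.rpos
  have hQ2 := hQ.two_mul_lt
  have hd := H.dist_eq_of_proj_ne hQ.1 hne
  have n1 := dist_nonneg (x := x) (y := proj Q x)
  have n2 := dist_nonneg (x := proj Q x) (y := proj Q y)
  have n3 := dist_nonneg (x := proj Q y) (y := y)
  have hy := H.dist_eq_of_proj_ne_base hQ.1 hQ.proj_ne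
  have heq : ∀ P ≠ Q, H.Long P x ∨ H.Long P y → proj P x = proj P y := by
    intro P hPQ hP
    have hPX : P ∈ PX := by rcases hP with hP | hP <;> exact hP.1
    by_contra h
    rcases H.shallow_or_shallow hPX hQ.1 hPQ hxy h hne with ⟨h1, h2⟩ | ⟨h1, h2⟩
    · rcases hP with hP | hP <;> linarith [hP.two_mul_lt]
    · linarith
  have hbefore : ∀ P ≠ Q, H.Long P y →
      dist xhat (proj P y) ≤ dist xhat (proj Q xhat) ∧ proj P (proj Q xhat) = proj P y := by
    intro P hPQ hP
    rcases H.before_or_before hP.1 hQ.1 hPQ hP.proj_ne hQ.proj_ne with h | ⟨h, -⟩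
    · exact h
    · have h1 := hP.two_mul_lt
      have h2 := H.dist_eq_of_proj_ne_base hP.1 hP.proj_ne
      have h3 := H.dist_base_proj_eq hP.1 y
      linarith [dist_nonneg (x := proj P y) (y := y)]
  refine ⟨by linarith, ⟨fun P hP => ?_, Or.inr ⟨Q, hQ, rfl⟩⟩, fun P hPQ hP => ?_, fun h => ?_⟩
  · by_cases hPQ : P = Q
    · rw [hPQ]
    · have h1 := (hbefore P hPQ hP).1
      have h2 := H.dist_base_proj_eq hQ.1 y
      linarith
  · rcases hP with hP | hP | hP
    · have e := heq P hPQ (Or.inl hP)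
      have h2 := (hbefore P hPQ ((H.long_congr e).1 hP)).2
      exact ⟨e.trans h2.symm, h2.symm⟩
    · have h2 := (hbefore P hPQ hP).2
      exact ⟨(heq P hPQ (Or.inr hP)).trans h2.symm, h2.symm⟩
    · have e := H.proj_eq_proj_base hP.1 hQ.1 hPQ hQ.proj_ne hP.proj_ne
      exact ⟨(heq P hPQ (Or.inr ((H.long_congr e).2 hP))).trans e, e⟩
  · rw [h] at hd n1
    linarith

lemma Long.longEq_base_of_step {H : ColoringSetup X PX n r fr xhat proj cP} (hQ : H.Long Q y)
    (hxy : dist x y < r) (hx : ¬ H.Long Q x) : H.LongEq x (proj Q xhat) := by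
  have hne : proj Q x ≠ proj Q y := fun h => hx ((H.long_congr h).2 hQ)
  intro P hP
  by_cases hPQ : P = Q
  · subst hPQ
    rcases hP with hP | hP
    · exact absurd hP hx
    · exact absurd (H.proj_self hQ.1 (H.projMem P hQ.1 xhat)) hP.proj_ne
  · refine ((hQ.step hxy hne).2.2.1 P hPQ ?_).1
    rcases hP with hP | hP
    exacts [Or.inl hP, Or.inr (Or.inr hP)]

/-- The long pieces of `x` end at `a`, and the unreduced part after `a` contributes `K` to the
color of `x`. -/
def InBand (H : ColoringSetup X PX n r fr xhat proj cP) (cX : X → Fin (n + 1)) (a : X) (K : ℕ)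
    (x : X) : Prop :=
  H.IsAnchor a x ∧ (cX x : ℕ) ≡ cX a + K [MOD n + 1] ∧
    ∃ e, H.IsResidue a x e ∧ ⌊e / (99 * fr)⌋₊ = K

lemma IsAnchor.exists_inBand {H : ColoringSetup X PX n r fr xhat proj cP}
    (h : H.IsAnchor a x) (hcX : H.IsColoring cX) : ∃ K, H.InBand cX a K x := by
  obtain ⟨e, he, hc⟩ := h.exists_color_modEq hcX
  exact ⟨_, h, hc, e, he, rfl⟩

lemma InBand.bounds {H : ColoringSetup X PX n r fr xhat proj cP} (h : H.InBand cX a K x) :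
    99 * fr * K ≤ dist a x ∧ dist a x < 99 * fr * K + 107 * fr := by
  obtain ⟨h1, -, e, he, rfl⟩ := h
  have hF := H.frpos
  have hd := h1.dist_eq
  have h2 := Nat.floor_le (div_nonneg he.nonneg (by positivity : 0 ≤ 99 * fr))
  have h3 := Nat.lt_floor_add_one (e / (99 * fr))
  rw [le_div_iff₀ (by positivity)] at h2
  rw [div_lt_iff₀ (by positivity)] at h3
  have h4 := he.le_sub
  have h5 := he.sub_le
  constructor <;> linarith

lemma IsAnchor.inBand_zero {H : ColoringSetup X PX n r fr xhat proj cP}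
    (h : H.IsAnchor a x) (hcX : H.IsColoring cX) (hd : dist a x < r) : H.InBand cX a 0 x := by
  obtain ⟨K, hK⟩ := h.exists_inBand hcX
  obtain rfl : K = 0 := by
    by_contra hne
    have h1 : (1 : ℝ) ≤ K := by exact_mod_cast Nat.one_le_iff_ne_zero.2 hne
    have h2 := hK.bounds.1
    have h3 := H.rlefr
    have h4 := H.frpos
    nlinarith
  exact hK

lemma InBand.color_eq {H : ColoringSetup X PX n r fr xhat proj cP} (h : H.InBand cX a 0 x) :
    cX x = cX a := by
  have h1 := h.2.1
  rw [add_zero] at h1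
  exact Fin.ext (Nat.ModEq.eq_of_lt_of_lt h1 (cX x).2 (cX a).2)

lemma Long.self {H : ColoringSetup X PX n r fr xhat proj cP} (h : H.Long Q x) :
    H.Long Q (proj Q x) :=
  (H.long_congr (H.proj_self h.1 (H.projMem Q h.1 x))).2 h

/-- How the color of a point can remain the same along a short step not moving the anchor. -/
lemma InBand.step {H : ColoringSetup X PX n r fr xhat proj cP} (hcX : H.IsColoring cX)
    (h : H.InBand cX a K x) (hxy : dist x y < r) (hc : cX x = cX y)
    (ha : a = xhat ∨ ∃ Q, H.Long Q x ∧ a = proj Q x ∧ a = proj Q y) :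
    H.InBand cX a K y ∨ ∃ Q, H.Long Q y ∧ ¬ H.Long Q x ∧ H.IsAnchor a (proj Q xhat) ∧
      99 * fr * K - 9 * fr ≤ dist xhat (proj Q xhat) - dist xhat a ∧
      dist xhat (proj Q xhat) - dist xhat a < 99 * fr * K := by
  have hF := H.frpos
  have hr := H.rlefr
  obtain ⟨hax, hcx, e, he, hK⟩ := h
  have hM : 0 < 99 * fr := by positivity
  by_cases hE : H.LongEq x y
  · left
    have hay := hax.congr hE
    obtain ⟨e', he', hc'⟩ := hay.exists_color_modEq hcX
    have h1 := dist_triangle xhat x y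
    have h2 := dist_triangle xhat y x
    rw [dist_comm y x] at h2
    have := eq_of_add_modEq_of_le H.npos ((hcx.symm.trans (by rw [hc])).trans hc')
      (by rw [← hK]
          exact floor_div_le_add_one hM he'.nonneg (by linarith [he'.sub_le, he.le_sub]))
      (by rw [← hK]
          exact floor_div_le_add_one hM he.nonneg (by linarith [he.sub_le, he'.le_sub]))
    exact ⟨hay, by rw [← hc]; exact hcx, e', he', this.symm⟩
  · right
    simp only [LongEq, not_forall] at hE
    obtain ⟨Q, hQ, hne⟩ := hE
    have hQx : ¬ H.Long Q x := by
      intro hQx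
      have hyx : dist y x < r := by rwa [dist_comm]
      obtain ⟨-, -, h3, -⟩ := hQx.step hyx (Ne.symm hne)
      have h4 := hax.1 Q hQx
      have h5 := hQx.two_mul_lt
      have h6 := H.dist_base_proj_eq hQx.1 x
      have h7 := H.rpos
      rcases ha with rfl | ⟨Q₀, hQ₀, ha, ha'⟩
      · rw [dist_self] at h4
        linarith [dist_nonneg (x := a) (y := proj Q a)]
      · have hQQ : Q₀ ≠ Q := by
          rintro rfl
          exact hne (ha.symm.trans ha')
        have h8 := (h3 Q₀ hQQ (Or.inr (Or.inl hQ₀))).2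
        have h9 := H.dist_eq_of_proj_ne_base hQ₀.1 (h8 ▸ hQ₀.proj_ne)
        rw [← h8, ← ha] at h9
        linarith [dist_nonneg (x := a) (y := proj Q xhat)]
    have hQy : H.Long Q y := hQ.resolve_left hQx
    obtain ⟨h1, h2, -, h4⟩ := hQy.step hxy hne
    have hab := hax.congr (hQy.longEq_base_of_step hxy hQx)
    have hD0 := hab.dist_eq
    have hD1 := dist_nonneg (x := a) (y := proj Q xhat)
    have h5 := he.base_le Q hQy.1 h4 (by linarith)
    have h6 := H.dist_le_of_not_long hQy.1 hQx
    have h7 := H.dist_eq_of_proj_ne_base hQy.1 h4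
    have h8 := H.dist_base_proj_eq hQy.1 x
    have h9 := he.le_sub
    have n1 := dist_nonneg (x := x) (y := proj Q x)
    have n2 := dist_nonneg (x := proj Q x) (y := proj Q y)
    have n3 := dist_nonneg (x := proj Q y) (y := y)
    rw [dist_comm (proj Q x) x] at h7
    have hK1 := Nat.floor_le (div_nonneg he.nonneg hM.le)
    have hK2 := Nat.lt_floor_add_one (e / (99 * fr))
    rw [le_div_iff₀ hM, hK] at hK1
    rw [div_lt_iff₀ hM, hK] at hK2
    refine ⟨Q, hQy, hQx, hab, by linarith, ?_⟩
    by_contra! hlt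
    have hfl : ⌊(dist xhat (proj Q xhat) - dist xhat a) / (99 * fr)⌋₊ = K := by
      rw [Nat.floor_eq_iff (div_nonneg (by linarith) hM.le), le_div_iff₀ hM, div_lt_iff₀ hM]
      constructor <;> linarith
    have hW := H.color_modEq_of_mem hcX hQy.self (H.projMem Q hQy.1 y) hab
    rw [hfl, ← (h2.inBand_zero hcX (by linarith)).color_eq, ← hc] at hW
    have h10 : 0 ≡ (cP Q (proj Q y) : ℕ) [MOD n + 1] :=
      Nat.ModEq.add_left_cancel' (cX a + K : ℕ) (hcx.symm.trans hW)
    have h11 := Nat.ModEq.eq_of_lt_of_lt h10 (by omega) (cP Q (proj Q y)).2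
    exact H.not_long_of_step hQy.1 hQx (by linarith) (Fin.ext h11.symm) hQy

/-- `x` is close to the long piece `Q`, and its projection to `Q` is in the `r`-component of `q₁`
with respect to the coloring of `Q`. -/
def NearPiece (H : ColoringSetup X PX n r fr xhat proj cP) (cX : X → Fin (n + 1)) (Q : Set X)
    (q₁ x : X) : Prop :=
  H.Long Q x ∧ H.InBand cX (proj Q x) 0 x ∧
    IsDChain dist r {z | z ∈ Q ∧ cP Q z = cP Q q₁} q₁ (proj Q x)

lemma Long.nearPiece {H : ColoringSetup X PX n r fr xhat proj cP} (hcX : H.IsColoring cX)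
    (hQ : H.Long Q y) (hxy : dist x y < r) (hne : proj Q x ≠ proj Q y) :
    H.NearPiece cX Q (proj Q y) y := by
  obtain ⟨h1, h2, -, -⟩ := hQ.step hxy hne
  refine ⟨hQ, h2.inBand_zero hcX ?_, IsDChain.refl ⟨H.projMem Q hQ.1 y, rfl⟩⟩
  linarith [dist_nonneg (x := x) (y := proj Q x), dist_nonneg (x := proj Q x) (y := proj Q y)]

lemma NearPiece.step {H : ColoringSetup X PX n r fr xhat proj cP} (hcX : H.IsColoring cX)
    (h : H.NearPiece cX Q q₁ x) (hxy : dist x y < r) (hc : cX x = cX y) (hQy : H.Long Q y) :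
    H.NearPiece cX Q q₁ y := by
  obtain ⟨hQx, hb, hch⟩ := h
  by_cases he : proj Q x = proj Q y
  · rw [he] at hch
    refine ⟨hQy, ?_, hch⟩
    rcases hb.step hcX hxy hc (Or.inr ⟨Q, hQx, rfl, he⟩) with h | ⟨P, -, -, h1, -, h2⟩
    · rwa [he] at h
    · have := h1.dist_eq
      simp only [Nat.cast_zero, mul_zero] at h2
      linarith [dist_nonneg (x := proj Q x) (y := proj P xhat)]
  · have h1 := (hQy.step hxy he).1
    have hb' := (hQy.nearPiece hcX hxy he).2.1
    refine ⟨hQy, hb', hch.snoc ⟨H.projMem Q hQy.1 y, ?_⟩ ?_⟩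
    · obtain ⟨α, hα⟩ := H.exists_isAnchor (proj Q xhat)
      have w1 := H.color_modEq_of_mem hcX hQx.self (H.projMem Q hQx.1 x) hα
      have w2 := H.color_modEq_of_mem hcX hQy.self (H.projMem Q hQy.1 y) hα
      rw [← hb.color_eq, hc] at w1
      rw [← hb'.color_eq] at w2
      have w3 := Nat.ModEq.add_left_cancel' _ (w2.symm.trans w1)
      rw [← hch.right_mem.2]
      exact Fin.ext (Nat.ModEq.eq_of_lt_of_lt w3 (Fin.is_lt _) (Fin.is_lt _))
    · linarith [dist_nonneg (x := x) (y := proj Q x), dist_nonneg (x := proj Q y) (y := y)]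

lemma NearPiece.dist_lt {H : ColoringSetup X PX n r fr xhat proj cP}
    (h : H.NearPiece cX Q q₁ x) : dist (proj Q x) x < 107 * fr := by
  have := h.2.1.bounds.2
  simpa using this

/-- `x` is in the band of level `K` after `a`, or in a long piece starting just before this
band. -/
def InBandOrNear (H : ColoringSetup X PX n r fr xhat proj cP) (cX : X → Fin (n + 1)) (a : X)
    (K : ℕ) (x : X) : Prop :=
  H.InBand cX a K x ∨ ∃ Q q₁, H.NearPiece cX Q q₁ x ∧ H.IsAnchor a (proj Q xhat) ∧
    99 * fr * K - 9 * fr ≤ dist xhat (proj Q xhat) - dist xhat a ∧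
    dist xhat (proj Q xhat) - dist xhat a < 99 * fr * K ∧
    dist (proj Q xhat) q₁ ≤ 9 * fr ∧ cP Q q₁ ≠ 0 ∧ (cX x : ℕ) ≡ cX a + K [MOD n + 1]

lemma InBandOrNear.step {H : ColoringSetup X PX n r fr xhat proj cP} (hcX : H.IsColoring cX)
    (h : H.InBandOrNear cX a K x) (hxy : dist x y < r) (hc : cX x = cX y)
    (ha : a = xhat ∨ ∃ Q, H.Long Q x ∧ a = proj Q x ∧ a = proj Q y) :
    H.InBandOrNear cX a K y := by
  have hF := H.frpos
  have hr := H.rlefr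
  have hM : 0 < 99 * fr := by positivity
  rcases h with h | ⟨Q, q₁, h, hab, h1, h2, h3, h4, h5⟩
  · rcases h.step hcX hxy hc ha with h' | ⟨Q, hQy, hQx, hab, h1, h2⟩
    · exact Or.inl h'
    · right
      have hne : proj Q x ≠ proj Q y := fun h => hQx ((H.long_congr h).2 hQy)
      have s1 := (hQy.step hxy hne).1
      have s2 := H.dist_le_of_not_long hQy.1 hQx
      have s3 := dist_triangle (proj Q xhat) (proj Q x) (proj Q y)
      have n1 := dist_nonneg (x := x) (y := proj Q x)
      have n3 := dist_nonneg (x := proj Q y) (y := y)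
      refine ⟨Q, proj Q y, hQy.nearPiece hcX hxy hne, hab, h1, h2, by linarith, fun h0 => ?_, ?_⟩
      · exact H.not_long_of_step hQy.1 hQx (by linarith) h0 hQy
      · rw [← hc]
        exact h.2.1
  · by_cases hQy : H.Long Q y
    · exact Or.inr ⟨Q, q₁, h.step hcX hxy hc hQy, hab, h1, h2, h3, h4, by rwa [← hc]⟩
    · left
      have hQx := h.1
      have hyx : dist y x < r := by rwa [dist_comm]
      have hne : proj Q y ≠ proj Q x := fun h => hQy ((H.long_congr h).2 hQx)
      obtain ⟨s1, -, -, s2⟩ := hQx.step hyx hne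
      have hay := hab.congr (hQx.longEq_base_of_step hyx hQy).symm
      obtain ⟨e, he, hce⟩ := hay.exists_color_modEq hcX
      have hD0 := hab.dist_eq
      have s3 := he.base_le Q hQx.1 s2 (by linarith [dist_nonneg (x := a) (y := proj Q xhat)])
      have s4 := he.le_sub
      have s5 := H.dist_eq_of_proj_ne_base hQx.1 s2
      have s6 := H.dist_base_proj_eq hQx.1 y
      have s7 := H.dist_le_of_not_long hQx.1 hQy
      have n1 := dist_nonneg (x := proj Q x) (y := x)
      have n2 := dist_nonneg (x := proj Q y) (y := proj Q x)
      rw [dist_comm (proj Q y) y] at s5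
      have hfl : ⌊(99 * fr * K) / (99 * fr)⌋₊ = K := by
        rw [mul_div_cancel_left₀ _ hM.ne', Nat.floor_natCast]
      refine ⟨hay, by rwa [← hc], e, he, ?_⟩
      refine eq_of_add_modEq_of_le H.npos ((hce.symm.trans (by rw [hc])).trans h5) ?_ ?_
      · have := floor_div_le_add_one (e := e) hM (by positivity : 0 ≤ 99 * fr * K) (by linarith)
        rwa [hfl] at this
      · have := floor_div_le_add_one (e := 99 * fr * K) hM he.nonneg (by linarith)
        rwa [hfl] at this

lemma dist_le_of_near {H : ColoringSetup X PX n r fr xhat proj cP}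
    (h : H.NearPiece cX Q q₁ x) (hq : cP Q q₁ ≠ 0) (hd : dist (proj Q xhat) q₁ ≤ 9 * fr) :
    dist (proj Q xhat) (proj Q x) ≤ 10 * fr := by
  have h1 := H.nonzeroBounded Q h.1.1 _ hq _ _ h.2.2
  linarith [dist_triangle (proj Q xhat) q₁ (proj Q x)]

lemma InBandOrNear.bounds {H : ColoringSetup X PX n r fr xhat proj cP}
    (h : H.InBandOrNear cX a K x) : 99 * fr * K - 9 * fr ≤ dist xhat x - dist xhat a ∧
      dist xhat x - dist xhat a ≤ 99 * fr * K + 117 * fr := by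
  have hF := H.frpos
  rcases h with h | ⟨Q, q₁, h, hab, h1, h2, h3, h4, h5⟩
  · have h1 := h.bounds
    have h2 := h.1.dist_eq
    constructor <;> linarith
  · have s1 := dist_le_of_near h h4 h3
    have s2 := h.dist_lt
    have s3 := H.dist_base_proj_eq h.1.1 x
    have s4 := H.dist_eq_of_proj_ne_base h.1.1 h.1.proj_ne
    have n1 := dist_nonneg (x := proj Q xhat) (y := proj Q x)
    have n2 := dist_nonneg (x := proj Q x) (y := x)
    constructor <;> linarith

lemma InBandOrNear.dist_proj_le {H : ColoringSetup X PX n r fr xhat proj cP}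
    (h : H.InBandOrNear cX a K x) (hP : P ∈ PX) (hax : dist xhat x = dist xhat a + dist a x)
    (hb : dist a (proj P x) + dist (proj P x) x = dist a x) (hne : proj P x ≠ a) :
    dist (proj P xhat) (proj P x) ≤ 10 * fr := by
  have hF := H.frpos
  by_cases hl : H.Long P x
  swap
  · linarith [H.dist_le_of_not_long hP hl]
  have h1 := H.dist_eq_of_proj_ne_base hP hl.proj_ne
  have h2 := dist_pos.2 hne.symm
  rcases h with h | ⟨Q, q₁, h, hab, h1, h2, h3, h4, h5⟩
  · linarith [h.1.1 P hl]
  · by_cases hPQ : P = Q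
    · subst hPQ
      exact dist_le_of_near h h4 h3
    · have s1 := h.2.1.1.1 P hl
      rcases H.before_or_before hP h.1.1 hPQ hl.proj_ne h.1.proj_ne with ⟨-, s⟩ | ⟨s, -⟩
      · have s2 := hab.1 P ((H.long_congr s).2 hl)
        rw [s] at s2
        linarith
      · have s2 := hl.two_mul_lt
        have s3 := H.dist_base_proj_eq hP x
        linarith [H.rpos]

end ColoringSetup

end Steps

section Bound

variable {X : Type*} [MetricSpace X] {PX : Set (Set X)} {n : ℕ} {r fr : ℝ} {xhat : X}
  {proj : Set X → X → X} {cP : Set X → X → Fin (n + 1)}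

lemma forall_le_of_step {p : ℕ → Prop} {m i₀ : ℕ} (hi₀ : i₀ ≤ m) (h : p i₀)
    (hstep : ∀ i < m, p i ↔ p (i + 1)) : ∀ i ≤ m, p i := by
  have h0 : ∀ i ≤ m, p i ↔ p 0 := by
    intro i
    induction i with
    | zero => simp
    | succ i ih => exact fun hi => (hstep i hi).symm.trans (ih (by omega))
  exact fun i hi => (h0 i hi).2 ((h0 i₀ hi₀).1 h)

namespace ColoringSetup

variable {Q : Set X} {a : X} {cX : X → Fin (n + 1)} {c : ℕ → X} {m i₀ : ℕ}

/-- A monochromatic chain whose points all lie beyond the anchor of one of them is bounded. -/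
lemma dist_le_of_isAnchor (H : ColoringSetup X PX n r fr xhat proj cP) (hcX : H.IsColoring cX)
    (hstep : ∀ i < m, dist (c i) (c (i + 1)) < r) (hc : ∀ i < m, cX (c i) = cX (c (i + 1)))
    (hi₀ : i₀ ≤ m) (hanchor : H.IsAnchor a (c i₀))
    (ha : a = xhat ∨ ∃ Q, ∀ i ≤ m, H.Long Q (c i) ∧ a = proj Q (c i)) :
    dist (c 0) (c m) ≤ 300 * fr := by
  have hF := H.frpos
  have hr := H.rlefr
  obtain ⟨K, hK⟩ := hanchor.exists_inBand hcX
  have hall : ∀ i ≤ m, H.InBandOrNear cX a K (c i) := by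
    refine forall_le_of_step hi₀ (Or.inl hK) fun i hi =>
      ⟨fun h => h.step hcX (hstep i hi) (hc i hi) ?_,
        fun h => h.step hcX (by rw [dist_comm]; exact hstep i hi) (hc i hi).symm ?_⟩
    · exact ha.imp_right fun ⟨Q, hQ⟩ =>
        ⟨Q, (hQ i hi.le).1, (hQ i hi.le).2, (hQ (i + 1) hi).2⟩
    · exact ha.imp_right fun ⟨Q, hQ⟩ =>
        ⟨Q, (hQ (i + 1) hi).1, (hQ (i + 1) hi).2, (hQ i hi.le).2⟩
  have hbetween : ∀ i ≤ m, dist xhat (c i) = dist xhat a + dist a (c i) := by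
    intro i hi
    rcases ha with rfl | ⟨Q, hQ⟩
    · simp
    · rw [(hQ i hi).2]
      exact H.dist_eq_of_proj_ne_base (hQ i hi).1.1 (hQ i hi).1.proj_ne
  have hbd : ∀ i ≤ m, 99 * fr * K - 9 * fr ≤ dist a (c i) ∧
      dist a (c i) ≤ 99 * fr * K + 117 * fr := by
    intro i hi
    have h1 := (hall i hi).bounds
    rw [hbetween i hi, add_sub_cancel_left] at h1
    exact h1
  obtain ⟨p, q, hp, hq, ⟨i, hi, hip⟩, ⟨j, hj, hjq⟩, hpq⟩ := H.exists_branching a hstep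
  have b0 := (hbd 0 (Nat.zero_le m)).2
  have bm := (hbd m le_rfl).2
  have bi := (hbd i hi).1
  have bj := (hbd j hj).1
  have ti := dist_triangle_right a (c i) p
  have tj := dist_triangle_right a (c j) q
  have t := dist_triangle4 (c 0) p q (c m)
  rw [dist_comm (c 0) p] at t
  rcases hpq with rfl | ⟨P, hP, rfl, rfl, hpa, hqa⟩
  · rw [dist_self] at t
    linarith
  · have e0 := (hall 0 (Nat.zero_le m)).dist_proj_le hP (hbetween 0 (Nat.zero_le m)) hp hpa
    have em := (hall m le_rfl).dist_proj_le hP (hbetween m le_rfl) hq hqa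
    have t' := dist_triangle_left (proj P (c 0)) (proj P (c m)) (proj P xhat)
    linarith

/-- A monochromatic chain beyond a long piece and moving the projection to this piece is
bounded. -/
lemma dist_le_of_proj_ne (H : ColoringSetup X PX n r fr xhat proj cP) (hcX : H.IsColoring cX)
    (hstep : ∀ i < m, dist (c i) (c (i + 1)) < r) (hc : ∀ i < m, cX (c i) = cX (c (i + 1)))
    (hQ : ∀ i ≤ m, H.Long Q (c i)) (hi₀ : i₀ < m) (hne : proj Q (c i₀) ≠ proj Q (c (i₀ + 1))) :
    dist (c 0) (c m) ≤ 300 * fr := by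
  have hF := H.frpos
  have hsymm : ∀ i < m, dist (c (i + 1)) (c i) < r := fun i hi => by
    rw [dist_comm]
    exact hstep i hi
  have hQX := (hQ 0 (Nat.zero_le m)).1
  set q := proj Q (c (i₀ + 1))
  have hall : ∀ i ≤ m, H.NearPiece cX Q q (c i) :=
    forall_le_of_step (Nat.succ_le_iff.2 hi₀)
      ((hQ (i₀ + 1) hi₀).nearPiece hcX (hstep i₀ hi₀) hne) fun i hi =>
        ⟨fun h => h.step hcX (hstep i hi) (hc i hi) (hQ (i + 1) hi),
          fun h => h.step hcX (hsymm i hi) (hc i hi).symm (hQ i hi.le)⟩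
  have hd : ∀ i ≤ m, dist q (proj Q (c i)) ≤ 8 * fr := by
    intro i hi
    have h := (hall i hi).2.2
    by_cases h0 : cP Q q = 0
    · rw [h0] at h
      exact H.zeroBounded Q hQX _ _ h
    · linarith [H.nonzeroBounded Q hQX _ h0 _ _ h]
  have h1 := (hall 0 (Nat.zero_le m)).dist_lt
  have h2 := (hall m le_rfl).dist_lt
  have h3 := hd 0 (Nat.zero_le m)
  have h4 := hd m le_rfl
  have h5 := dist_triangle_left (proj Q (c 0)) (proj Q (c m)) q
  have h6 := dist_triangle4 (c 0) (proj Q (c 0)) (proj Q (c m)) (c m)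
  rw [dist_comm (c 0) (proj Q (c 0))] at h6
  linarith

/-- If a chain leaves a long piece `Q`, the last long piece of some point of the chain starts
before `Q`. -/
lemma Long.of_step {H : ColoringSetup X PX n r fr xhat proj cP} {P : Set X} {x y : X}
    (hQ : H.Long Q x) (hxy : dist x y < r) (hP : H.Long P y)
    (hmin : dist xhat (proj Q xhat) ≤ dist xhat (proj P xhat)) : H.Long Q y := by
  by_contra hy
  have hE := hQ.longEq_base_of_step (by rwa [dist_comm]) hy
  have h1 := hE.long_iff.1 hP
  have h2 := H.dist_eq_of_proj_ne_base hP.1 h1.proj_ne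
  have h3 := H.dist_base_proj_eq hP.1 (proj Q xhat)
  have h4 := h1.two_mul_lt
  linarith [H.rpos, dist_nonneg (x := proj P (proj Q xhat)) (y := proj Q xhat)]

/-- Monochromatic chains are bounded. -/
lemma dist_le_of_chain (H : ColoringSetup X PX n r fr xhat proj cP) (hcX : H.IsColoring cX)
    (hstep : ∀ i < m, dist (c i) (c (i + 1)) < r) (hc : ∀ i < m, cX (c i) = cX (c (i + 1))) :
    dist (c 0) (c m) ≤ 300 * fr := by
  by_cases hlong : ∃ i ≤ m, H.IsAnchor xhat (c i)
  · obtain ⟨i, hi, h⟩ := hlong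
    exact H.dist_le_of_isAnchor hcX hstep hc hi h (Or.inl rfl)
  have hQ : ∀ i, ∃ Q, i ≤ m → H.Long Q (c i) ∧ H.IsAnchor (proj Q (c i)) (c i) := by
    intro i
    by_cases hi : i ≤ m
    · obtain ⟨α, hα⟩ := H.exists_isAnchor (c i)
      rcases hα.2 with ⟨rfl, -⟩ | ⟨Q, hQ, rfl⟩
      · exact absurd ⟨i, hi, hα⟩ hlong
      · exact ⟨Q, fun _ => ⟨hQ, hα⟩⟩
    · exact ⟨∅, fun h => absurd h hi⟩
  choose Q hQ using hQ
  obtain ⟨i₀, hi₀, hmin⟩ := Finset.exists_min_image (Finset.range (m + 1))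
    (fun i => dist xhat (proj (Q i) xhat)) ⟨0, by simp⟩
  simp only [Finset.mem_range, Nat.lt_succ_iff] at hi₀ hmin
  have hall : ∀ i ≤ m, H.Long (Q i₀) (c i) :=
    forall_le_of_step hi₀ (hQ i₀ hi₀).1 fun i hi =>
      ⟨fun h => h.of_step (hstep i hi) (hQ (i + 1) hi).1 (hmin (i + 1) hi),
        fun h => h.of_step (by rw [dist_comm]; exact hstep i hi) (hQ i hi.le).1 (hmin i hi.le)⟩
  by_cases hne : ∃ i < m, proj (Q i₀) (c i) ≠ proj (Q i₀) (c (i + 1))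
  · obtain ⟨i, hi, hne⟩ := hne
    exact H.dist_le_of_proj_ne hcX hstep hc hall hi hne
  · push Not at hne
    refine H.dist_le_of_isAnchor hcX hstep hc hi₀ (hQ i₀ hi₀).2 (Or.inr ⟨Q i₀, ?_⟩)
    have hproj := forall_le_of_step (p := fun i => proj (Q i₀) (c i₀) = proj (Q i₀) (c i)) hi₀ rfl
      fun i hi => by rw [hne i hi]
    exact fun i hi => ⟨hall i hi, hproj i hi⟩

end ColoringSetup

end Bound

/-- In the Setup: any two points of the same `c*_X`-color connected by an `r`-chain of
that color are at distance at most `300·f(r)`; consequently every `r`-scale connected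
component of each `c*_X`-color class is `300·f(r)`-bounded and `X` has dimension `≤ n`
at the scale `r` of magnitude `300·f(r)`. -/
theorem cX_components_bounded (X : Type*) [MetricSpace X] [CompleteSpace X]
    (PX : Set (Set X)) (n : ℕ) (r fr : ℝ) (xhat : X)
    (proj : Set X → X → X) (cP : Set X → X → Fin (n + 1))
    (hsetup : ColoringSetup X PX n r fr xhat proj cP)
    (cX : X → Fin (n + 1))
    (hcX : ∀ (γ : ℝ → X) (L : ℝ), 0 ≤ L → IsGeodesicSegment γ 0 L → γ 0 = xhat →
      ColorValue PX r fr xhat proj cP γ L (cX (γ L))) :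
    (∀ x' x'' : X, cX x' = cX x'' →
      IsDChain dist r {z : X | cX z = cX x'} x' x'' → dist x' x'' ≤ 300 * fr) ∧
    (∀ (j : Fin (n + 1)) (C : Set X),
      IsDComponent dist r {z : X | cX z = j} C → DBounded dist (300 * fr) C) ∧
    DimLeAtScale (dist : X → X → ℝ) n r (300 * fr) := by
  have hchain : ∀ (j : Fin (n + 1)) (x' x'' : X),
      IsDChain dist r {z : X | cX z = j} x' x'' → dist x' x'' ≤ 300 * fr := by
    rintro j _ _ ⟨m, c, rfl, rfl, hc, hstep⟩
    exact hsetup.dist_le_of_chain hcX hstep fun i hi =>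
      (hc i hi.le).trans (hc (i + 1) hi).symm
  have hcomp : ∀ (j : Fin (n + 1)) (C : Set X),
      IsDComponent dist r {z : X | cX z = j} C → DBounded dist (300 * fr) C := by
    rintro j C ⟨hsub, hconn, -⟩ x hx y hy
    obtain ⟨m, c, h0, h1, hc, hstep⟩ := hconn x hx y hy
    exact hchain j x y ⟨m, c, h0, h1, fun i hi => hsub (hc i hi), hstep⟩
  exact ⟨fun x' x'' _ h => hchain _ x' x'' h, hcomp, fun j => {z | cX z = j},
    fun y => ⟨cX y, rfl⟩, hcomp⟩
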